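/- arXiv:2603.08539 — 5 statements merged into one kernel-verified Lean document; each statement's English description precedes it below -/
import Mathlib

section
/- Let n, d be positive integers, G a connected subgraph of K_{n,d}, and M a G-tropical oriented matroid. Let H ∈ M be a type, and let Fin n = I_1 ⊔ I_2 and Fin d = J_1 ⊔ J_2 be partitions such that E(H) ⊆ (I_1 × J_1) ∪ (I_2 × J_2), the bipartite graph E(H) ∩ (I_1 × J_1) on vertex set I_1 ⊕ J_1 is connected, and the bipartite graph E(H) ∩ (I_2 × J_2) on vertex set I_2 ⊕ J_2 is connected. Suppose G has at least one edge in I_1 × J_2 and at least one edge in I_2 × J_1. Then there exist types C_1, C_2 ∈ M with connected graphs E(C_1), E(C_2), both containing H (that is, H_i ⊆ (C_1)_i and H_i ⊆ (C_2)_i for all i), such that E(C_1) contains an edge in I_1 × J_2, E(C_2) contains an edge in I_2 × J_1, and C_1 ≠ C_2. -/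
open Finset Pointwise

/-- The bipartite graph on vertex set `α ⊕ β` whose edges are the pairs in `S`. -/
def bipGraph {α β : Type*} (S : Set (α × β)) : SimpleGraph (α ⊕ β) where
  Adj u v := ∃ a b, (a, b) ∈ S ∧
    ((u = Sum.inl a ∧ v = Sum.inr b) ∨ (u = Sum.inr b ∧ v = Sum.inl a))
  symm := by
    constructor
    rintro u v ⟨a, b, h, (⟨rfl, rfl⟩ | ⟨rfl, rfl⟩)⟩
    · exact ⟨a, b, h, Or.inr ⟨rfl, rfl⟩⟩
    · exact ⟨a, b, h, Or.inl ⟨rfl, rfl⟩⟩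
  loopless := by
    constructor
    rintro u ⟨a, b, h, (⟨rfl, hv⟩ | ⟨rfl, hv⟩)⟩ <;> simp at hv

/-- The edge set of an `(n,d)`-type. -/
def typeEdges {n d : ℕ} (A : Fin n → Finset (Fin d)) : Set (Fin n × Fin d) :=
  {p | p.2 ∈ A p.1}

/-- A subgraph of `K_{n,d}` is connected. -/
def IsConn {n d : ℕ} (S : Set (Fin n × Fin d)) : Prop :=
  (bipGraph S).Connected

/-- `A` is an `(n,d)`-type: every coordinate is nonempty. -/
def IsType {n d : ℕ} (A : Fin n → Finset (Fin d)) : Prop := ∀ i, (A i).Nonempty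

/-- Compatibility of two subgraphs of `K_{n,d}`. -/
def Compatible {n d : ℕ} (A B : Set (Fin n × Fin d)) : Prop :=
  ∀ (k : ℕ) (i : Fin (k + 2) → Fin n) (j : Fin (k + 2) → Fin d),
    Function.Injective i → Function.Injective j →
    (∀ t, (i t, j t) ∈ A) → (∀ t, (i (t + 1), j t) ∈ B) →
    ∀ t, (i t, j t) ∈ A ∧ (i t, j t) ∈ B ∧ (i (t + 1), j t) ∈ A ∧ (i (t + 1), j t) ∈ B

/-- An ordered partition of `Fin d` into nonempty parts. -/
structure OrderedPartition (d : ℕ) where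
  r : ℕ
  parts : Fin r → Finset (Fin d)
  nonempty : ∀ k, (parts k).Nonempty
  disjoint : ∀ k l, k ≠ l → Disjoint (parts k) (parts l)
  covers : ∀ j, ∃ k, j ∈ parts k

/-- `B` is the refinement of `A` with respect to the ordered partition `P`. -/
def IsRefinement {n d : ℕ} (A : Fin n → Finset (Fin d)) (P : OrderedPartition d)
    (B : Fin n → Finset (Fin d)) : Prop :=
  ∀ i, ∃ k, B i = A i ∩ P.parts k ∧ (A i ∩ P.parts k).Nonempty ∧
    ∀ l, l < k → A i ∩ P.parts l = ∅

/-- `B` is the total refinement of `A` with respect to the linear order on `Fin d` whose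
rank function is `σ`. -/
def IsTotalRefinement {n d : ℕ} (A : Fin n → Finset (Fin d)) (σ : Equiv.Perm (Fin d))
    (B : Fin n → Finset (Fin d)) : Prop :=
  ∀ i, ∃ j ∈ A i, B i = {j} ∧ ∀ j' ∈ A i, σ j ≤ σ j'

/-- The type associated to a subgraph `G` of `K_{n,d}`. -/
def graphType {n d : ℕ} (G : Finset (Fin n × Fin d)) : Fin n → Finset (Fin d) :=
  fun i => Finset.univ.filter fun j => (i, j) ∈ G

/-- `M` is a `G`-tropical oriented matroid. -/
structure IsGTOM {n d : ℕ} (G : Finset (Fin n × Fin d))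
    (M : Set (Fin n → Finset (Fin d))) : Prop where
  isType : ∀ A ∈ M, IsType A
  subgraph : ∀ A ∈ M, typeEdges A ⊆ (↑G : Set (Fin n × Fin d))
  boundary : ∀ (σ : Equiv.Perm (Fin d)) (B : Fin n → Finset (Fin d)),
    IsTotalRefinement (graphType G) σ B → B ∈ M
  surrounding : ∀ A ∈ M, ∀ (P : OrderedPartition d) (B : Fin n → Finset (Fin d)),
    IsRefinement A P B → B ∈ M
  comparability : ∀ A ∈ M, ∀ B ∈ M, Compatible (typeEdges A) (typeEdges B)
  elimination : ∀ A ∈ M, ∀ B ∈ M, ∀ i : Fin n, ∃ C ∈ M,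
    C i = A i ∪ B i ∧ ∀ i', C i' = A i' ∨ C i' = B i' ∨ C i' = A i' ∪ B i'

/-- The vertex of `Δ^{n-1} × Δ^{d-1}` associated to a pair `(i, j)`. -/
def rootVert {n d : ℕ} (p : Fin n × Fin d) : (Fin n → ℝ) × (Fin d → ℝ) :=
  (Pi.single p.1 1, Pi.single p.2 1)

/-- The root polytope `Q_S` of a subgraph `S ⊆ K_{n,d}`. -/
def rootPoly {n d : ℕ} (S : Set (Fin n × Fin d)) : Set ((Fin n → ℝ) × (Fin d → ℝ)) :=
  convexHull ℝ (rootVert '' S)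

/-- A collection `𝒢` of subgraphs encodes a polyhedral subdivision of `Q_G`. -/
def EncodesSubdivision {n d : ℕ} (G : Set (Fin n × Fin d))
    (𝒢 : Set (Set (Fin n × Fin d))) : Prop :=
  (⋃ S ∈ 𝒢, rootPoly S) = rootPoly G ∧
  ∀ S ∈ 𝒢, ∀ T ∈ 𝒢, IsExtreme ℝ (rootPoly S) (rootPoly S ∩ rootPoly T) ∧
    IsExtreme ℝ (rootPoly T) (rootPoly S ∩ rootPoly T)

/-- Connectivity of the edge set `S` restricted to the vertex sets `I ⊕ J`. -/
def connOn {n d : ℕ} (I : Set (Fin n)) (J : Set (Fin d)) (S : Set (Fin n × Fin d)) : Prop :=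
  (bipGraph {p : ↥I × ↥J | ((p.1 : Fin n), (p.2 : Fin d)) ∈ S}).Connected

/-- The generalized permutohedron (Minkowski sum of faces of the simplex). -/
def gPerm {n d : ℕ} (J : Fin n → Finset (Fin d)) : Set (Fin d → ℝ) :=
  ∑ i : Fin n, convexHull ℝ ((fun j => Pi.single j (1 : ℝ)) '' ↑(J i))

namespace TOMProof

open Relation

set_option linter.unusedSectionVars false

variable {α β : Type*} [DecidableEq α] [DecidableEq β]

/-- Directed step from `i` to `i'` through an element of `A i ∩ B i'`. -/
def Rel (I : Finset α) (A B : α → Finset β) : α → α → Prop :=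
  fun i i' => i ∈ I ∧ i' ∈ I ∧ ∃ j, j ∈ A i ∧ j ∈ B i'

/-- The consequence of compatibility that is used throughout. -/
def KK (I : Finset α) (A B : α → Finset β) : Prop :=
  ∀ i ∈ I, ∀ i' ∈ I, ∀ j, j ∈ A i → j ∈ B i' → ReflTransGen (Rel I A B) i' i → j ∈ B i

/-- Connectivity of `H` on `I ⊔ J`. -/
structure Conn (I : Finset α) (J : Finset β) (H : α → Finset β) : Prop where
  lk : ∀ i ∈ I, ∀ i' ∈ I, ReflTransGen (Rel I H H) i i'
  cov : I.Nonempty → ∀ j ∈ J, ∃ i ∈ I, j ∈ H i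
  sg : I = ∅ → ∀ j ∈ J, ∀ j' ∈ J, j = j'

/-- The version of the axioms with a varying index set. -/
structure TOM (I : Finset α) (G : α → Finset β) (M : Set (α → Finset β)) : Prop where
  ne : ∀ A ∈ M, ∀ i ∈ I, (A i).Nonempty
  sub : ∀ A ∈ M, ∀ i ∈ I, A i ⊆ G i
  bd : ∀ r : β → ℕ, Function.Injective r → ∃ A ∈ M, ∀ i ∈ I, ∃ j ∈ G i, A i = {j} ∧
    ∀ j' ∈ G i, r j ≤ r j'
  sur : ∀ A ∈ M, ∀ U : Finset β, ∃ B ∈ M, ∀ i ∈ I,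
    B i = if (A i ∩ U).Nonempty then A i ∩ U else A i
  cmp : ∀ A ∈ M, ∀ B ∈ M, KK I A B
  elim : ∀ A ∈ M, ∀ B ∈ M, ∀ i ∈ I, ∃ C ∈ M, C i = A i ∪ B i ∧
    ∀ i' ∈ I, C i' = A i' ∨ C i' = B i' ∨ C i' = A i' ∪ B i'


lemma Rel.mono {I I' : Finset α} {A B A' B' : α → Finset β} (hI : I' ⊆ I)
    (hA : ∀ i ∈ I', A' i ⊆ A i) (hB : ∀ i ∈ I', B' i ⊆ B i) {i i' : α}
    (h : ReflTransGen (Rel I' A' B') i i') : ReflTransGen (Rel I A B) i i' := by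
  refine ReflTransGen.mono ?_ _ _ h
  rintro a b ⟨ha, hb, j, h1, h2⟩
  exact ⟨hI ha, hI hb, j, hA a ha h1, hB b hb h2⟩

lemma Rel.rev {I : Finset α} {A B : α → Finset β} {i i' : α}
    (h : ReflTransGen (Rel I A B) i i') : ReflTransGen (Rel I B A) i' i := by
  rw [← reflTransGen_swap] at h
  refine ReflTransGen.mono ?_ _ _ h
  rintro a b ⟨ha, hb, j, h1, h2⟩
  exact ⟨hb, ha, j, h2, h1⟩

lemma KK.mono {I I' : Finset α} {A B : α → Finset β} (hI : I' ⊆ I) (h : KK I A B) :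
    KK I' A B := fun i hi i' hi' j h1 h2 h3 =>
  h i (hI hi) i' (hI hi') j h1 h2 (Rel.mono hI (fun _ _ => Finset.Subset.refl _)
    (fun _ _ => Finset.Subset.refl _) h3)

/-- Elements of minimal level. -/
def Gl (l : β → ℕ) (G : α → Finset β) : α → Finset β :=
  fun i => (G i).filter fun j => ∀ j' ∈ G i, l j ≤ l j'

lemma mem_Gl {l : β → ℕ} {G : α → Finset β} {i : α} {j : β} :
    j ∈ Gl l G i ↔ j ∈ G i ∧ ∀ j' ∈ G i, l j ≤ l j' := by
  simp [Gl]

/-- Passing to a face at infinity and deleting hyperplanes. -/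
lemma TOM.face [Finite β] {I I' : Finset α} {G : α → Finset β} {M : Set (α → Finset β)}
    (h : TOM I G M) (hI : I' ⊆ I) (l : β → ℕ) :
    TOM I' (Gl l G) {A | A ∈ M ∧ ∀ i ∈ I, A i ⊆ Gl l G i} where
  ne := fun A hA i hi => h.ne A hA.1 i (hI hi)
  sub := fun A hA i hi => hA.2 i (hI hi)
  bd := by
    intro r hr
    cases nonempty_fintype β
    obtain ⟨N, hN⟩ : ∃ N, ∀ j, r j < N :=
      ⟨(Finset.univ.sup r) + 1, fun j => Nat.lt_succ_of_le (Finset.le_sup (Finset.mem_univ j))⟩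
    have key : ∀ j j', l j * N + r j ≤ l j' * N + r j' → l j ≤ l j' := by
      intro j j' hle
      by_contra hlt
      push Not at hlt
      have h1 : (l j' + 1) * N ≤ l j * N := Nat.mul_le_mul_right _ hlt
      have := hN j'
      nlinarith
    obtain ⟨A, hA, hA'⟩ := h.bd (fun j => l j * N + r j) (by
      intro j j' hjj
      simp only at hjj
      have h1 := key j j' hjj.le
      have h2 := key j' j hjj.ge
      have h3 : l j = l j' := le_antisymm h1 h2
      rw [h3] at hjj
      exact hr (by omega))
    refine ⟨A, ⟨hA, ?_⟩, ?_⟩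
    · intro i hi
      obtain ⟨j, hj, hAj, hmin⟩ := hA' i hi
      rw [hAj]
      simp only [Finset.singleton_subset_iff, mem_Gl]
      exact ⟨hj, fun j' hj' => key _ _ (hmin j' hj')⟩
    · intro i hi
      obtain ⟨j, hj, hAj, hmin⟩ := hA' i (hI hi)
      refine ⟨j, mem_Gl.2 ⟨hj, fun j' hj' => key _ _ (hmin j' hj')⟩, hAj, ?_⟩
      intro j' hj'
      have h1 := (mem_Gl.1 hj').2 j hj
      have h2 := key _ _ (hmin j' (mem_Gl.1 hj').1)
      have h3 : l j = l j' := le_antisymm h2 h1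
      have h4 := hmin j' (mem_Gl.1 hj').1
      simp only [h3] at h4
      omega
  sur := by
    rintro A ⟨hA, hA'⟩ U
    obtain ⟨B, hB, hB'⟩ := h.sur A hA U
    refine ⟨B, ⟨hB, ?_⟩, fun i hi => hB' i (hI hi)⟩
    intro i hi
    rw [hB' i hi]
    split_ifs
    · exact Finset.inter_subset_left.trans (hA' i hi)
    · exact hA' i hi
  cmp := fun A hA B hB => (h.cmp A hA.1 B hB.1).mono hI
  elim := by
    rintro A ⟨hA, hA'⟩ B ⟨hB, hB'⟩ i hi
    obtain ⟨C, hC, h1, h2⟩ := h.elim A hA B hB i (hI hi)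
    refine ⟨C, ⟨hC, ?_⟩, h1, fun i' hi' => h2 i' (hI hi')⟩
    intro k hk
    rcases h2 k hk with h3 | h3 | h3 <;> rw [h3]
    · exact hA' k hk
    · exact hB' k hk
    · exact Finset.union_subset (hA' k hk) (hB' k hk)

/-- A non-cut vertex. -/
lemma exists_noncut {I : Finset α} {H : α → Finset β} (hne : I.Nonempty)
    (hl : ∀ i ∈ I, ∀ i' ∈ I, ReflTransGen (Rel I H H) i i') :
    ∃ i ∈ I, ∀ k ∈ I.erase i, ∀ k' ∈ I.erase i,
      ReflTransGen (Rel (I.erase i) H H) k k' := by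
  classical
  let Γ : SimpleGraph I :=
    { Adj := fun a b => a ≠ b ∧ ∃ j, j ∈ H a ∧ j ∈ H b
      symm := ⟨fun a b ⟨h1, j, h2, h3⟩ => ⟨h1.symm, j, h3, h2⟩⟩
      loopless := ⟨fun a h => h.1 rfl⟩ }
  have hconn : Γ.Connected := by
    have : Nonempty I := hne.to_subtype
    refine SimpleGraph.Connected.mk ?_
    have : ∀ a b, ReflTransGen (Rel I H H) a b → ∀ (ha : a ∈ I) (hb : b ∈ I),
        Γ.Reachable ⟨a, ha⟩ ⟨b, hb⟩ := by
      intro a b hab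
      induction hab with
      | refl => intro ha hb; exact SimpleGraph.Reachable.refl _
      | tail h1 h2 ih =>
        rename_i b c
        intro ha hc
        obtain ⟨hb, _, j, hj1, hj2⟩ := h2
        refine (ih ha hb).trans ?_
        by_cases hbc : b = c
        · subst hbc; exact SimpleGraph.Reachable.refl _
        · exact SimpleGraph.Adj.reachable
            (⟨fun h => hbc (congrArg Subtype.val h), j, hj1, hj2⟩ : Γ.Adj ⟨b, hb⟩ ⟨c, hc⟩)
    intro a b
    exact this a b (hl a a.2 b b.2) a.2 b.2
  by_cases hnt : Nontrivial I
  · obtain ⟨v, hv⟩ := hconn.exists_connected_induce_compl_singleton_of_finite_nontrivial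
    refine ⟨v, v.2, ?_⟩
    intro k hk k' hk'
    have hkI := Finset.mem_of_mem_erase hk
    have hkI' := Finset.mem_of_mem_erase hk'
    have e1 : (⟨k, hkI⟩ : I) ∈ ({v}ᶜ : Set I) := by
      intro h; exact (Finset.ne_of_mem_erase hk) (congrArg Subtype.val h)
    have e2 : (⟨k', hkI'⟩ : I) ∈ ({v}ᶜ : Set I) := by
      intro h; exact (Finset.ne_of_mem_erase hk') (congrArg Subtype.val h)
    have hr := hv.preconnected ⟨_, e1⟩ ⟨_, e2⟩
    rw [SimpleGraph.reachable_iff_reflTransGen] at hr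
    have := ReflTransGen.lift (p := Rel (I.erase v) H H)
      (fun x : ({v}ᶜ : Set I) => (x.1 : α)) ?_ _ _ hr
    · exact this
    · rintro a b hab
      have hab' : Γ.Adj a.1 b.1 := hab
      obtain ⟨_, j, h1, h2⟩ := hab'
      refine ⟨?_, ?_, j, h1, h2⟩
      · refine Finset.mem_erase.2 ⟨fun h => a.2 (Subtype.ext h), a.1.2⟩
      · refine Finset.mem_erase.2 ⟨fun h => b.2 (Subtype.ext h), b.1.2⟩
  · rw [not_nontrivial_iff_subsingleton] at hnt
    obtain ⟨i, hi⟩ := hne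
    refine ⟨i, hi, ?_⟩
    intro k hk
    exact absurd (congrArg Subtype.val (Subsingleton.elim (⟨k, Finset.mem_of_mem_erase hk⟩ : I) ⟨i, hi⟩))
      (Finset.ne_of_mem_erase hk)

/-- The leaves of `i` in `J`. -/
def leaves (I : Finset α) (J : Finset β) (H : α → Finset β) (i : α) : Finset β :=
  J.filter fun j => ∀ k ∈ I.erase i, j ∉ H k

lemma mem_leaves {I : Finset α} {J : Finset β} {H : α → Finset β} {i : α} {j : β} :
    j ∈ leaves I J H i ↔ j ∈ J ∧ ∀ k ∈ I.erase i, j ∉ H k := by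
  simp only [leaves, Finset.mem_filter]

lemma not_mem_leaves {I : Finset α} {J : Finset β} {H : α → Finset β} {i : α} {j : β}
    (hj : j ∈ J) (h : j ∉ leaves I J H i) : ∃ k ∈ I.erase i, j ∈ H k := by
  by_contra hc
  push Not at hc
  exact h (mem_leaves.2 ⟨hj, hc⟩)

lemma leaves_sub {I : Finset α} {J : Finset β} {H : α → Finset β} (hc : Conn I J H) {i : α}
    (hi : i ∈ I) : leaves I J H i ⊆ H i := by
  intro j hj
  obtain ⟨hjJ, hj⟩ := mem_leaves.1 hj
  obtain ⟨k, hk, hjk⟩ := hc.cov ⟨i, hi⟩ j hjJ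
  by_cases hki : k = i
  · rwa [hki] at hjk
  · exact absurd hjk (hj k (Finset.mem_erase.2 ⟨hki, hk⟩))

lemma conn_erase {I : Finset α} {J : Finset β} {H : α → Finset β} {i : α}
    (h : ∀ k ∈ I.erase i, ∀ k' ∈ I.erase i, ReflTransGen (Rel (I.erase i) H H) k k') :
    Conn (I.erase i) (J \ leaves I J H i) H where
  lk := h
  cov := fun _ j hj => not_mem_leaves (Finset.mem_sdiff.1 hj).1 (Finset.mem_sdiff.1 hj).2
  sg := by
    intro he j hj
    obtain ⟨k, hk, _⟩ := not_mem_leaves (Finset.mem_sdiff.1 hj).1 (Finset.mem_sdiff.1 hj).2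
    rw [he] at hk
    simp at hk

lemma Conn.mono {I : Finset α} {J : Finset β} {H H' : α → Finset β} (hc : Conn I J H)
    (h : ∀ i ∈ I, H i ⊆ H' i) : Conn I J H' where
  lk := fun i hi i' hi' => Rel.mono (Finset.Subset.refl _) h h (hc.lk i hi i' hi')
  cov := fun hI j hj => by
    obtain ⟨i, hi, hji⟩ := hc.cov hI j hj
    exact ⟨i, hi, h i hi hji⟩
  sg := hc.sg

/-- If there is another vertex, then `i` has a neighbour. -/
lemma exists_nbr {I : Finset α} {H : α → Finset β} {i : α} (hi : i ∈ I)
    (hl : ∀ i ∈ I, ∀ i' ∈ I, ReflTransGen (Rel I H H) i i') (hne : (I.erase i).Nonempty) :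
    ∃ k ∈ I.erase i, ∃ j, j ∈ H i ∧ j ∈ H k := by
  obtain ⟨m, hm⟩ := hne
  have hmi := Finset.ne_of_mem_erase hm
  have := hl i hi m (Finset.mem_of_mem_erase hm)
  by_contra hc
  push Not at hc
  have : ∀ x, ReflTransGen (Rel I H H) i x → x = i := by
    intro x hx
    induction hx with
    | refl => rfl
    | tail h1 h2 ih =>
      rename_i b c
      subst ih
      obtain ⟨_, hcI, j, hj1, hj2⟩ := h2
      by_contra hcb
      exact hc c (Finset.mem_erase.2 ⟨hcb, hcI⟩) j hj1 hj2
  exact hmi (this m (hl i hi m (Finset.mem_of_mem_erase hm)))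

/-- Compatibility with `H` determines `A i` when `H ⊆ A` away from `i`. -/
lemma lemQ1 {I I₁ : Finset α} {J : Finset β} {A H : α → Finset β} {i : α} (hI : I₁ ⊆ I)
    (hi : i ∈ I₁) (hnc : Conn (I₁.erase i) (J \ leaves I₁ J H i) H)
    (hHA : KK I H A) (hsub : ∀ k ∈ I₁.erase i, H k ⊆ A k)
    {j : β} (hj : j ∈ A i) (hjJ : j ∈ J) (hjL : j ∉ leaves I₁ J H i)
    (hHJ : H i ⊆ J) :
    H i \ leaves I₁ J H i ⊆ A i := by
  intro j2 hj2
  obtain ⟨hj2, hj2L⟩ := Finset.mem_sdiff.1 hj2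
  obtain ⟨k, hk, hjk⟩ := not_mem_leaves hjJ hjL
  obtain ⟨k2, hk2, hjk2⟩ := not_mem_leaves (hHJ hj2) hj2L
  have hkI := hI (Finset.mem_of_mem_erase hk)
  have hk2I := hI (Finset.mem_of_mem_erase hk2)
  refine hHA i (hI hi) k2 hk2I j2 hj2 (hsub k2 hk2 hjk2) ?_
  apply Rel.rev
  refine ReflTransGen.head (⟨hI hi, hkI, j, hj, hjk⟩ : Rel I A H i k) ?_
  exact Rel.mono ((Finset.erase_subset _ _).trans hI) hsub (fun _ _ => Finset.Subset.refl _)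
    (hnc.lk k hk k2 hk2)

/-- Successive elimination at `i`. -/
lemma elim_union {I : Finset α} {G : α → Finset β} {M : Set (α → Finset β)} (hT : TOM I G M)
    {i : α} (hi : i ∈ I) {C : α → Finset β} (B : Finset β) (L : Finset β)
    (h0 : ∃ A ∈ M, (∀ k ∈ I.erase i, C k ⊆ A k) ∧ B ⊆ A i)
    (hE : ∀ j ∈ L, ∃ E ∈ M, (∀ k ∈ I.erase i, C k ⊆ E k) ∧ j ∈ E i) :
    ∃ A ∈ M, (∀ k ∈ I.erase i, C k ⊆ A k) ∧ B ∪ L ⊆ A i := by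
  induction L using Finset.induction_on with
  | empty => simpa using h0
  | insert j L hjL ih =>
    obtain ⟨A, hA, hAC, hAB⟩ := ih (fun j' hj' => hE j' (Finset.mem_insert_of_mem hj'))
    obtain ⟨E, hEM, hEC, hEj⟩ := hE j (Finset.mem_insert_self _ _)
    obtain ⟨D, hD, hDi, hDk⟩ := hT.elim A hA E hEM i hi
    refine ⟨D, hD, ?_, ?_⟩
    · intro k hk
      rcases hDk k (Finset.mem_of_mem_erase hk) with h | h | h <;> rw [h]
      · exact hAC k hk
      · exact hEC k hk
      · exact (hAC k hk).trans Finset.subset_union_left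
    · rw [hDi]
      intro x hx
      simp only [Finset.mem_union, Finset.mem_insert] at hx ⊢
      rcases hx with hx | rfl | hx
      · exact Or.inl (hAB (Finset.mem_union_left _ hx))
      · exact Or.inr hEj
      · exact Or.inl (hAB (Finset.mem_union_right _ hx))

/-- Statement `R`. -/
def PR (α β : Type*) [DecidableEq α] [DecidableEq β] (n : ℕ) : Prop :=
  ∀ (I : Finset α) (G : α → Finset β) (M : Set (α → Finset β)) (J : Finset β)
    (H : α → Finset β), I.card = n → TOM I G M → (∀ i ∈ I, H i ⊆ G i) →
    (∀ i ∈ I, (H i).Nonempty) → (∀ i ∈ I, G i ⊆ J) → Conn I J H →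
    (∀ A ∈ M, KK I A H ∧ KK I H A) → ∃ A ∈ M, ∀ i ∈ I, A i = H i

/-- Statement `S`. -/
def PS (α β : Type*) [DecidableEq α] [DecidableEq β] (n : ℕ) : Prop :=
  ∀ (I : Finset α) (G : α → Finset β) (M : Set (α → Finset β)) (I₁ I₂ : Finset α)
    (J₁ J₂ : Finset β) (H : α → Finset β), I.card = n → TOM I G M → I₁ ∪ I₂ = I →
    Disjoint I₁ I₂ → Disjoint J₁ J₂ → (∀ i ∈ I, G i ⊆ J₁ ∪ J₂) → H ∈ M →
    (∀ i ∈ I₁, H i ⊆ J₁) → (∀ i ∈ I₂, H i ⊆ J₂) → Conn I₁ J₁ H → Conn I₂ J₂ H →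
    (∃ i ∈ I₁, ∃ j ∈ J₂, j ∈ G i) →
    ∃ C ∈ M, (∀ i ∈ I, H i ⊆ C i) ∧ ∃ i ∈ I₁, ∃ j ∈ C i, j ∈ J₂

lemma lemE [Finite β] {n : ℕ} (hPR : PR α β n) (hPS : PS α β n) {I : Finset α}
    {G : α → Finset β}
    {M : Set (α → Finset β)} {J L : Finset β} {C : α → Finset β} {i : α} {j' : β}
    (hcard : (I.erase i).card = n) (hT : TOM I G M) (hi : i ∈ I) (hG : ∀ k ∈ I, G k ⊆ J)
    (hjL : j' ∈ L) (hjG : j' ∈ G i) (hC : C ∈ M) (hCL : ∀ k ∈ I, Disjoint (C k) L)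
    (hconn : Conn (I.erase i) (J \ L) C) :
    ∃ E ∈ M, (∀ k ∈ I.erase i, C k ⊆ E k) ∧ E i ⊆ G i \ (L.erase j') ∧
      ((∃ k ∈ I.erase i, j' ∈ E k) ∨ E i = {j'}) := by
  have hIe := Finset.erase_subset i I
  by_cases h : ∃ k ∈ I.erase i, j' ∈ G k
  · set l : β → ℕ := fun j => if j ∈ L.erase j' then 1 else 0 with hl
    have hGl : ∀ k ∈ I, Gl l G k = G k \ L.erase j' := by
      intro k hk
      obtain ⟨c, hc⟩ := hT.ne C hC k hk
      have hcG := hT.sub C hC k hk hc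
      have hcL : c ∉ L := Finset.disjoint_left.1 (hCL k hk) hc
      ext j
      rw [mem_Gl, Finset.mem_sdiff]
      constructor
      · rintro ⟨h1, h2⟩
        refine ⟨h1, fun h3 => ?_⟩
        have := h2 c hcG
        simp only [hl, h3, if_true] at this
        rw [if_neg (fun h => hcL (Finset.mem_of_mem_erase h))] at this
        omega
      · rintro ⟨h1, h2⟩
        refine ⟨h1, fun _ _ => ?_⟩
        simp only [hl, h2, if_false]
        exact Nat.zero_le _
    have hT' := hT.face hIe l
    obtain ⟨E, ⟨hEM, hEs⟩, hCE, k, hk, j, hjE, hjj⟩ := hPS (I.erase i) _ _ (I.erase i) ∅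
      (J \ L) {j'} C hcard hT' (by simp) (by simp)
      (by simp [hjL]) (by
        intro k hk j hj
        rw [hGl k (hIe hk)] at hj
        obtain ⟨h1, h2⟩ := Finset.mem_sdiff.1 hj
        have := hG k (hIe hk) h1
        simp only [Finset.mem_union, Finset.mem_sdiff, Finset.mem_singleton]
        by_cases hjj : j = j'
        · exact Or.inr hjj
        · exact Or.inl ⟨this, fun h => h2 (Finset.mem_erase.2 ⟨hjj, h⟩)⟩)
      ⟨hC, by
        intro k hk j hj
        rw [hGl k hk]
        exact Finset.mem_sdiff.2 ⟨hT.sub C hC k hk hj, fun h =>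
          Finset.disjoint_left.1 (hCL k hk) hj (Finset.mem_of_mem_erase h)⟩⟩
      (by
        intro k hk j hj
        exact Finset.mem_sdiff.2 ⟨hG k (hIe hk) (hT.sub C hC k (hIe hk) hj),
          Finset.disjoint_left.1 (hCL k (hIe hk)) hj⟩)
      (by simp) hconn
      ⟨by simp, by simp, by simp⟩
      (by
        obtain ⟨k, hk, hjk⟩ := h
        refine ⟨k, hk, j', by simp, ?_⟩
        rw [hGl k (hIe hk)]
        simp [hjk])
    refine ⟨E, hEM, hCE, ?_, Or.inl ⟨k, hk, ?_⟩⟩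
    · rw [← hGl i hi]; exact hEs i hi
    · rw [Finset.mem_singleton] at hjj
      rwa [hjj] at hjE
  · push Not at h
    set l : β → ℕ := fun j => if j = j' then 0 else if j ∈ L then 2 else 1 with hl
    have hGi : Gl l G i = {j'} := by
      ext j
      rw [mem_Gl, Finset.mem_singleton]
      constructor
      · rintro ⟨h1, h2⟩
        have := h2 j' hjG
        simp only [hl, if_true] at this
        by_contra hne
        rw [if_neg hne] at this
        split_ifs at this <;> omega
      · rintro rfl
        refine ⟨hjG, fun _ _ => by simp [hl]⟩
    have hGl : ∀ k ∈ I.erase i, Gl l G k = G k \ L := by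
      intro k hk
      obtain ⟨c, hc⟩ := hT.ne C hC k (hIe hk)
      have hcG := hT.sub C hC k (hIe hk) hc
      have hcL : c ∉ L := Finset.disjoint_left.1 (hCL k (hIe hk)) hc
      have hcj : c ≠ j' := fun h => hcL (h ▸ hjL)
      ext j
      rw [mem_Gl, Finset.mem_sdiff]
      constructor
      · rintro ⟨h1, h2⟩
        refine ⟨h1, fun h3 => ?_⟩
        have hjj : j ≠ j' := fun e => h k hk (e ▸ h1)
        have := h2 c hcG
        simp only [hl, h3, hjj, hcj, hcL, if_true, if_false] at this
        omega
      · rintro ⟨h1, h2⟩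
        refine ⟨h1, fun x hx => ?_⟩
        have hjj : j ≠ j' := fun e => h k hk (e ▸ h1)
        have hxj : x ≠ j' := fun e => h k hk (e ▸ hx)
        simp only [hl, h2, hjj, hxj, if_false]
        split_ifs <;> omega
    have hT' := hT.face hIe l
    obtain ⟨E, ⟨hEM, hEs⟩, hE⟩ := hPR (I.erase i) _ _ (J \ L) C hcard hT'
      (by
        intro k hk j hj
        rw [hGl k hk]
        exact Finset.mem_sdiff.2 ⟨hT.sub C hC k (hIe hk) hj,
          Finset.disjoint_left.1 (hCL k (hIe hk)) hj⟩)
      (fun k hk => hT.ne C hC k (hIe hk))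
      (by
        intro k hk
        rw [hGl k hk]
        exact Finset.sdiff_subset_sdiff (hG k (hIe hk)) (Finset.Subset.refl _))
      hconn
      (fun A hA => ⟨(hT.cmp A hA.1 C hC).mono hIe, (hT.cmp C hC A hA.1).mono hIe⟩)
    have hEi : E i = {j'} := by
      have h1 := hEs i hi
      rw [hGi] at h1
      exact (hT.ne E hEM i hi).subset_singleton_iff.1 h1
    refine ⟨E, hEM, fun k hk => (hE k hk).ge, ?_, Or.inr hEi⟩
    rw [hEi]
    simp [hjG]

lemma Gl_ind {G : α → Finset β} {L : Finset β} {k : α} (h : ∃ c ∈ G k, c ∉ L) :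
    Gl (fun j => if j ∈ L then 1 else 0) G k = G k \ L := by
  obtain ⟨c, hc, hcL⟩ := h
  ext j
  rw [mem_Gl, Finset.mem_sdiff]
  constructor
  · rintro ⟨h1, h2⟩
    refine ⟨h1, fun h3 => ?_⟩
    have := h2 c hc
    simp only [h3, hcL, if_true, if_false] at this
    omega
  · rintro ⟨h1, h2⟩
    refine ⟨h1, fun _ _ => ?_⟩
    simp only [h2, if_false]
    exact Nat.zero_le _

lemma TOM.nonempty [Finite β] {I : Finset α} {G : α → Finset β} {M : Set (α → Finset β)}
    (hT : TOM I G M) : ∃ A, A ∈ M := by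
  cases nonempty_fintype β
  obtain ⟨A, hA, _⟩ := hT.bd (fun j => (Fintype.equivFin β j : ℕ)) (by
    intro a b hab
    exact (Fintype.equivFin β).injective (Fin.ext hab))
  exact ⟨A, hA⟩

/-- For a single hyperplane, all subsets occur. -/
lemma single_all [Finite β] {I : Finset α} {G : α → Finset β} {M : Set (α → Finset β)}
    (hT : TOM I G M) {i : α} (hi : i ∈ I) (S : Finset β) (hS : S.Nonempty) (hSG : S ⊆ G i) :
    ∃ A ∈ M, A i = S := by
  have h1 : ∀ j ∈ G i, ∃ A ∈ M, A i = {j} := by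
    intro j hj
    have hT' := hT.face (Finset.Subset.refl I) (fun x => if x = j then 0 else 1)
    obtain ⟨A, hA, hA'⟩ := hT'.nonempty
    refine ⟨A, hA, ?_⟩
    refine (hT.ne A hA i hi).subset_singleton_iff.1 ?_
    intro x hx
    have := (mem_Gl.1 (hA' i hi hx)).2 j hj
    simp only [if_true] at this
    by_contra hne
    rw [if_neg (by simpa using hne)] at this
    omega
  induction hS using Finset.Nonempty.cons_induction with
  | singleton j => exact h1 j (hSG (by simp))
  | cons j S hjS hS ih =>
    obtain ⟨A, hA, hAS⟩ := ih (fun x hx => hSG (by simp [hx]))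
    obtain ⟨B, hB, hBj⟩ := h1 j (hSG (by simp))
    obtain ⟨C, hC, hCi, _⟩ := hT.elim A hA B hB i hi
    refine ⟨C, hC, ?_⟩
    rw [hCi, hAS, hBj, Finset.cons_eq_insert, Finset.union_comm, Finset.insert_eq]

lemma PR_zero [Finite β] : PR α β 0 := by
  intro I G M J H hI hT _ _ _ _ _
  rw [Finset.card_eq_zero] at hI
  subst hI
  obtain ⟨A, hA⟩ := hT.nonempty
  exact ⟨A, hA, by simp⟩

lemma PR_succ [Finite β] {n : ℕ} (hPR : PR α β n) (hPS : PS α β n) : PR α β (n + 1) := by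
  intro I G M J H hcard hT hHG hHne hGJ hconn hcomp
  have hIne : I.Nonempty := Finset.card_pos.1 (by omega)
  obtain ⟨i, hi, hnc⟩ := exists_noncut hIne hconn.lk
  have hIe := Finset.erase_subset i I
  have hce : (I.erase i).card = n := by rw [Finset.card_erase_of_mem hi]; omega
  by_cases hem : (I.erase i).Nonempty
  swap
  · rw [Finset.not_nonempty_iff_eq_empty] at hem
    obtain ⟨A, hA, hAi⟩ := single_all hT hi (H i) (hHne i hi) (hHG i hi)
    refine ⟨A, hA, fun k hk => ?_⟩
    by_cases hki : k = i
    · rw [hki, hAi]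
    · have : k ∈ I.erase i := Finset.mem_erase.2 ⟨hki, hk⟩
      rw [hem] at this
      simp at this
  have hce' := conn_erase (J := J) hnc
  set L := leaves I J H i with hL
  have hLH : L ⊆ H i := leaves_sub hconn hi
  have hkL : ∀ k ∈ I.erase i, ∀ j ∈ H k, j ∉ L := fun k hk j hj hjL =>
    (mem_leaves.1 hjL).2 k hk hj
  obtain ⟨k₁, hk₁, j₁, hj₁i, hj₁k⟩ := exists_nbr hi hconn.lk hem
  have hout : ∀ k ∈ I, ∃ c ∈ G k, c ∉ L := by
    intro k hk
    by_cases hki : k = i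
    · subst hki
      exact ⟨j₁, hHG k hi hj₁i, hkL k₁ hk₁ j₁ hj₁k⟩
    · have hk' : k ∈ I.erase i := Finset.mem_erase.2 ⟨hki, hk⟩
      obtain ⟨c, hc⟩ := hHne k hk
      exact ⟨c, hHG k hk hc, hkL k hk' c hc⟩
  have hT' := hT.face hIe (fun j => if j ∈ L then 1 else 0)
  obtain ⟨C, ⟨hCM, hCs⟩, hCH⟩ := hPR (I.erase i) _ _ (J \ L) H hce hT'
    (by
      intro k hk j hj
      rw [Gl_ind (hout k (hIe hk))]
      exact Finset.mem_sdiff.2 ⟨hHG k (hIe hk) hj, hkL k hk j hj⟩)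
    (fun k hk => hHne k (hIe hk))
    (by
      intro k hk
      rw [Gl_ind (hout k (hIe hk))]
      exact Finset.sdiff_subset_sdiff (hGJ k (hIe hk)) (Finset.Subset.refl _))
    hce'
    (fun A hA => ⟨(hcomp A hA.1).1.mono hIe, (hcomp A hA.1).2.mono hIe⟩)
  have hCL : ∀ k ∈ I, Disjoint (C k) L := by
    intro k hk
    have := hCs k hk
    rw [Gl_ind (hout k hk)] at this
    exact Finset.disjoint_left.2 fun x hx => (Finset.mem_sdiff.1 (this hx)).2
  have hHiJ : H i ⊆ J := (hHG i hi).trans (hGJ i hi)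
  have hCi : H i \ L ⊆ C i := by
    obtain ⟨j, hj⟩ := hT.ne C hCM i hi
    exact lemQ1 (Finset.Subset.refl I) hi hce' (hcomp C hCM).2 (fun k hk => (hCH k hk).ge) hj
      (hGJ i hi (hT.sub C hCM i hi hj)) (Finset.disjoint_left.1 (hCL i hi) hj) hHiJ
  have hE : ∀ j' ∈ L, ∃ E ∈ M, (∀ k ∈ I.erase i, H k ⊆ E k) ∧ j' ∈ E i := by
    intro j' hj'
    obtain ⟨E, hEM, hCE, hEi, hor⟩ := lemE hPR hPS hce hT hi hGJ hj' (hHG i hi (hLH hj')) hCM hCL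
      (hce'.mono (fun k hk => (hCH k hk).ge))
    have hHE : ∀ k ∈ I.erase i, H k ⊆ E k := fun k hk => (hCH k hk).ge.trans (hCE k hk)
    refine ⟨E, hEM, hHE, ?_⟩
    rcases hor with ⟨k, hk, hjk⟩ | h
    · by_contra hnot
      obtain ⟨j, hj⟩ := hT.ne E hEM i hi
      have hjj : j ≠ j' := fun e => hnot (e ▸ hj)
      obtain ⟨hjG, hjL⟩ := Finset.mem_sdiff.1 (hEi hj)
      have hjL' : j ∉ L := fun h => hjL (Finset.mem_erase.2 ⟨hjj, h⟩)
      obtain ⟨k3, hk3, hjk3⟩ := not_mem_leaves (hGJ i hi hjG) hjL'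
      have := (hcomp E hEM).1 k (hIe hk) i hi j' hjk (hLH hj') (by
        refine ReflTransGen.head (⟨hi, hIe hk3, j, hj, hjk3⟩ : Rel I E H i k3) ?_
        exact Rel.mono hIe hHE (fun _ _ => Finset.Subset.refl _) (hnc k3 hk3 k hk))
      exact hkL k hk j' this hj'
    · rw [h]; simp
  obtain ⟨A, hA, hAH, hAi⟩ := elim_union hT hi (C := H) (H i \ L) L
    ⟨C, hCM, fun k hk => (hCH k hk).ge, hCi⟩ hE
  have hHA : ∀ k ∈ I, H k ⊆ A k := by
    intro k hk
    by_cases hki : k = i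
    · subst hki
      rwa [Finset.sdiff_union_of_subset hLH] at hAi
    · exact hAH k (Finset.mem_erase.2 ⟨hki, hk⟩)
  refine ⟨A, hA, fun k hk => Finset.Subset.antisymm ?_ (hHA k hk)⟩
  intro j hj
  obtain ⟨m, hm, hjm⟩ := hconn.cov hIne j (hGJ k hk (hT.sub A hA k hk hj))
  exact (hcomp A hA).1 k hk m hm j hj hjm
    (Rel.mono (Finset.Subset.refl _) hHA (fun _ _ => Finset.Subset.refl _) (hconn.lk m hm k hk))

/-- `R` with two blocks. -/
lemma R_two [Finite β] {I IA IB : Finset α} {G : α → Finset β} {M : Set (α → Finset β)}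
    {JA JB : Finset β} {H : α → Finset β} (hPA : PR α β IA.card) (hPB : PR α β IB.card)
    (hT : TOM I G M) (hIA : IA ⊆ I) (hIB : IB ⊆ I) (hJ : Disjoint JA JB)
    (hGA : ∀ k ∈ IA, G k ⊆ JA) (hGB : ∀ k ∈ IB, G k ⊆ JB)
    (hHA : ∀ k ∈ IA, H k ⊆ G k) (hHB : ∀ k ∈ IB, H k ⊆ G k)
    (hneA : ∀ k ∈ IA, (H k).Nonempty) (hneB : ∀ k ∈ IB, (H k).Nonempty)
    (hcA : Conn IA JA H) (hcB : Conn IB JB H) (hcomp : ∀ A ∈ M, KK I A H ∧ KK I H A) :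
    ∃ A ∈ M, (∀ k ∈ IA, A k = H k) ∧ ∀ k ∈ IB, A k = H k := by
  have hT' : TOM IB G {A | A ∈ M ∧ ∀ k ∈ IA, A k = H k} :=
    { ne := fun A hA i hi => hT.ne A hA.1 i (hIB hi)
      sub := fun A hA i hi => hT.sub A hA.1 i (hIB hi)
      bd := by
        intro r hr
        set l : β → ℕ := fun j => if j ∈ JB then r j + 1 else 0 with hl
        have hTf := hT.face hIA l
        have hGl : ∀ k ∈ IA, Gl l G k = G k := by
          intro k hk
          ext j
          rw [mem_Gl]
          refine ⟨fun h => h.1, fun h => ⟨h, fun _ _ => ?_⟩⟩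
          simp only [hl, if_neg (Finset.disjoint_left.1 hJ (hGA k hk h))]
          exact Nat.zero_le _
        obtain ⟨A, ⟨hA, hAs⟩, hAH⟩ := hPA IA _ _ JA H rfl hTf
          (fun k hk => by rw [hGl k hk]; exact hHA k hk) hneA
          (fun k hk => by rw [hGl k hk]; exact hGA k hk) hcA
          (fun A hA => ⟨(hcomp A hA.1).1.mono hIA, (hcomp A hA.1).2.mono hIA⟩)
        refine ⟨A, ⟨hA, hAH⟩, ?_⟩
        intro k hk
        obtain ⟨j, hj⟩ := hT.ne A hA k (hIB hk)
        have hmin : ∀ x ∈ A k, ∀ y ∈ G k, r x ≤ r y := by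
          intro x hx y hy
          have h1 := mem_Gl.1 (hAs k (hIB hk) hx)
          have h2 := h1.2 y hy
          simp only [hl, if_pos (hGB k hk h1.1), if_pos (hGB k hk hy)] at h2
          omega
        have hjG := hT.sub A hA k (hIB hk) hj
        refine ⟨j, hjG, ?_, hmin j hj⟩
        ext x
        rw [Finset.mem_singleton]
        refine ⟨fun hx => hr (le_antisymm (hmin x hx j hjG)
          (hmin j hj x (hT.sub A hA k (hIB hk) hx))), fun hx => hx ▸ hj⟩
      sur := by
        rintro A ⟨hA, hAH⟩ U
        obtain ⟨B, hB, hBU⟩ := hT.sur A hA (U ∪ JA)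
        refine ⟨B, ⟨hB, ?_⟩, ?_⟩
        · intro k hk
          have h1 : A k ∩ (U ∪ JA) = A k := by
            rw [Finset.inter_eq_left, hAH k hk]
            exact ((hHA k hk).trans (hGA k hk)).trans Finset.subset_union_right
          rw [hBU k (hIA hk), h1, if_pos (hT.ne A hA k (hIA hk)), hAH k hk]
        · intro k hk
          have h1 : A k ∩ (U ∪ JA) = A k ∩ U := by
            ext x
            simp only [Finset.mem_inter, Finset.mem_union]
            refine ⟨?_, fun h => ⟨h.1, Or.inl h.2⟩⟩
            rintro ⟨h1, h2 | h2⟩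
            · exact ⟨h1, h2⟩
            · exact absurd (hGB k hk (hT.sub A hA k (hIB hk) h1)) (Finset.disjoint_left.1 hJ h2)
          rw [hBU k (hIB hk), h1]
      cmp := fun A hA B hB => (hT.cmp A hA.1 B hB.1).mono hIB
      elim := by
        rintro A ⟨hA, hAH⟩ B ⟨hB, hBH⟩ i hi
        obtain ⟨C, hC, h1, h2⟩ := hT.elim A hA B hB i (hIB hi)
        refine ⟨C, ⟨hC, ?_⟩, h1, fun k hk => h2 k (hIB hk)⟩
        intro k hk
        rcases h2 k (hIA hk) with h | h | h <;> rw [h]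
        · exact hAH k hk
        · exact hBH k hk
        · rw [hAH k hk, hBH k hk, Finset.union_self] }
  obtain ⟨A, ⟨hA, hAH⟩, hAB⟩ := hPB IB _ _ JB H rfl hT' hHB hneB hGB hcB
    (fun A hA => ⟨(hcomp A hA.1).1.mono hIB, (hcomp A hA.1).2.mono hIB⟩)
  exact ⟨A, hA, hAH, hAB⟩

lemma PS_zero : PS α β 0 := by
  intro I G M I₁ I₂ J₁ J₂ H hI hT hIu _ _ _ _ _ _ _ _ hfar
  rw [Finset.card_eq_zero] at hI
  subst hI
  obtain ⟨i, hi, _⟩ := hfar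
  have : i ∈ I₁ ∪ I₂ := Finset.mem_union_left _ hi
  rw [hIu] at this
  simp at this

lemma PS_succ [Finite β] {n : ℕ} (hPRs : ∀ m ≤ n, PR α β m) (hPS : PS α β n) :
    PS α β (n + 1) := by
  intro I G M I₁ I₂ J₁ J₂ H hcard hT hIu hId hJd hGJ hH hH1 hH2 hc1 hc2 hfar
  have hPR := hPRs n le_rfl
  have hI1 : I₁ ⊆ I := hIu ▸ Finset.subset_union_left
  have hI2 : I₂ ⊆ I := hIu ▸ Finset.subset_union_right
  have hne1 : I₁.Nonempty := by
    obtain ⟨i, hi, _⟩ := hfar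
    exact ⟨i, hi⟩
  obtain ⟨i, hi1, hnc⟩ := exists_noncut hne1 hc1.lk
  have hi := hI1 hi1
  have hi2 : i ∉ I₂ := Finset.disjoint_left.1 hId hi1
  have hIe := Finset.erase_subset i I
  have hce : (I.erase i).card = n := by rw [Finset.card_erase_of_mem hi]; omega
  have hI1e : I₁.erase i ⊆ I.erase i := Finset.erase_subset_erase i hI1
  have hI2e : I₂ ⊆ I.erase i := fun k hk =>
    Finset.mem_erase.2 ⟨fun e => hi2 (e ▸ hk), hI2 hk⟩
  have hsplit : ∀ k ∈ I.erase i, k ∈ I₁.erase i ∨ k ∈ I₂ := by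
    intro k hk
    have h1 := Finset.mem_of_mem_erase hk
    rw [← hIu, Finset.mem_union] at h1
    exact h1.imp (fun h => Finset.mem_erase.2 ⟨Finset.ne_of_mem_erase hk, h⟩) id
  -- it suffices to have a good type away from `i`
  have hdone : (∃ A ∈ M, (∀ k ∈ I.erase i, H k ⊆ A k) ∧ ∃ j ∈ A i, j ∈ J₂) →
      ∃ C ∈ M, (∀ i ∈ I, H i ⊆ C i) ∧ ∃ i ∈ I₁, ∃ j ∈ C i, j ∈ J₂ := by
    rintro ⟨A, hA, hAH, j, hj, hj2⟩
    obtain ⟨C, hC, hCi, hCk⟩ := hT.elim A hA H hH i hi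
    refine ⟨C, hC, ?_, i, hi1, j, ?_, hj2⟩
    · intro k hk
      by_cases hki : k = i
      · rw [hki, hCi]; exact Finset.subset_union_right
      · have hk' := hAH k (Finset.mem_erase.2 ⟨hki, hk⟩)
        rcases hCk k hk with h | h | h <;> rw [h]
        · exact hk'
        · exact Finset.subset_union_right
    · rw [hCi]; exact Finset.mem_union_left _ hj
  have hce' := conn_erase (J := J₁) hnc
  set L := leaves I₁ J₁ H i with hL
  have hLH : L ⊆ H i := leaves_sub hc1 hi1
  have hLJ : L ⊆ J₁ := fun j hj => (mem_leaves.1 hj).1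
  have hkL : ∀ k ∈ I.erase i, ∀ j ∈ H k, j ∉ L := by
    intro k hk j hj hjL
    rcases hsplit k hk with h | h
    · exact (mem_leaves.1 hjL).2 k h hj
    · exact Finset.disjoint_left.1 hJd (hLJ hjL) (hH2 k h hj)
  by_cases hA : ∃ k ∈ I₁.erase i, ∃ j ∈ J₂, j ∈ G k
  · obtain ⟨k₁, hk₁, j₁, hj₁i, hj₁k⟩ := exists_nbr hi1 hc1.lk ⟨hA.choose, hA.choose_spec.1⟩
    have hj₁L : j₁ ∉ L := hkL k₁ (hI1e hk₁) j₁ hj₁k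
    have hout : ∀ k ∈ I, ∃ c ∈ G k, c ∉ L := by
      intro k hk
      by_cases hki : k = i
      · subst hki
        exact ⟨j₁, hT.sub H hH k hk hj₁i, hj₁L⟩
      · have hk' : k ∈ I.erase i := Finset.mem_erase.2 ⟨hki, hk⟩
        obtain ⟨c, hc⟩ := hT.ne H hH k hk
        exact ⟨c, hT.sub H hH k hk hc, hkL k hk' c hc⟩
    cases nonempty_fintype β
    obtain ⟨H', hH', hH's⟩ := hT.sur H hH (Finset.univ \ L)
    have hinterE : ∀ k, H k ∩ (Finset.univ \ L) = H k \ L := by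
      intro k; ext x; simp
    have hH'k : ∀ k ∈ I.erase i, H' k = H k := by
      intro k hk
      have h1 : H k \ L = H k := by
        rw [Finset.sdiff_eq_self_iff_disjoint, Finset.disjoint_left]
        exact hkL k hk
      rw [hH's k (hIe hk), hinterE, h1, ite_self]
    have hH'i : H' i = H i \ L := by
      rw [hH's i hi, hinterE, if_pos ⟨j₁, Finset.mem_sdiff.2 ⟨hj₁i, hj₁L⟩⟩]
    have hT' := hT.face hIe (fun j => if j ∈ L then 1 else 0)
    obtain ⟨C, ⟨hCM, hCs⟩, hCH', k', hk', j2, hj2C, hj2⟩ := hPS (I.erase i) _ _ (I₁.erase i) I₂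
      (J₁ \ L) J₂ H' hce hT'
      (by
        apply Finset.Subset.antisymm
        · exact Finset.union_subset hI1e hI2e
        · intro k hk
          exact Finset.mem_union.2 (hsplit k hk))
      (Finset.disjoint_of_subset_left (Finset.erase_subset _ _) hId)
      (Finset.disjoint_of_subset_left Finset.sdiff_subset hJd)
      (by
        intro k hk j hj
        rw [Gl_ind (hout k (hIe hk))] at hj
        obtain ⟨h1, h2⟩ := Finset.mem_sdiff.1 hj
        rcases Finset.mem_union.1 (hGJ k (hIe hk) h1) with h3 | h3
        · exact Finset.mem_union_left _ (Finset.mem_sdiff.2 ⟨h3, h2⟩)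
        · exact Finset.mem_union_right _ h3)
      ⟨hH', by
        intro k hk j hj
        rw [Gl_ind (hout k hk)]
        refine Finset.mem_sdiff.2 ⟨hT.sub H' hH' k hk hj, ?_⟩
        by_cases hki : k = i
        · rw [hki, hH'i] at hj
          exact (Finset.mem_sdiff.1 hj).2
        · have hke : k ∈ I.erase i := Finset.mem_erase.2 ⟨hki, hk⟩
          rw [hH'k k hke] at hj
          exact hkL k hke j hj⟩
      (by
        intro k hk j hj
        rw [hH'k k (hI1e hk)] at hj
        exact Finset.mem_sdiff.2 ⟨hH1 k (Finset.mem_of_mem_erase hk) hj, hkL k (hI1e hk) j hj⟩)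
      (by
        intro k hk
        rw [hH'k k (hI2e hk)]
        exact hH2 k hk)
      (hce'.mono (fun k hk => (hH'k k (hI1e hk)).ge))
      (hc2.mono (fun k hk => (hH'k k (hI2e hk)).ge))
      (by
        obtain ⟨k, hk, j, hj, hjG⟩ := hA
        refine ⟨k, hk, j, hj, ?_⟩
        rw [Gl_ind (hout k (hIe (hI1e hk)))]
        exact Finset.mem_sdiff.2 ⟨hjG, fun h => Finset.disjoint_left.1 hJd (hLJ h) hj⟩)
    have hCH : ∀ k ∈ I.erase i, H k ⊆ C k := fun k hk => (hH'k k hk).ge.trans (hCH' k hk)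
    have hCL : ∀ k ∈ I, Disjoint (C k) L := by
      intro k hk
      have := hCs k hk
      rw [Gl_ind (hout k hk)] at this
      exact Finset.disjoint_left.2 fun x hx => (Finset.mem_sdiff.1 (this hx)).2
    by_cases hgood : ∃ A ∈ M, (∀ k ∈ I.erase i, H k ⊆ A k) ∧ ∃ j ∈ A i, j ∈ J₂
    · exact hdone hgood
    have hJ1 : ∀ A ∈ M, (∀ k ∈ I.erase i, H k ⊆ A k) → ∀ j ∈ A i, j ∈ J₁ := by
      intro A hA hAH j hj
      rcases Finset.mem_union.1 (hGJ i hi (hT.sub A hA i hi hj)) with h | h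
      · exact h
      · exact absurd ⟨A, hA, hAH, j, hj, h⟩ hgood
    have hCi : H i \ L ⊆ C i := by
      obtain ⟨j, hj⟩ := hT.ne C hCM i hi
      exact lemQ1 hI1 hi1 hce' (hT.cmp H hH C hCM) (fun k hk => hCH k (hI1e hk)) hj
        (hJ1 C hCM hCH j hj) (Finset.disjoint_left.1 (hCL i hi) hj) (hH1 i hi1)
    -- paths
    have hpath : ∀ A : α → Finset β, (∀ k ∈ I.erase i, C k ⊆ A k) → ∀ a ∈ I₁.erase i,
        ∀ b ∈ I.erase i, ReflTransGen (Rel (I.erase i) A H) a b := by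
      intro A hAC a ha b hb
      have hAH : ∀ k ∈ I.erase i, H k ⊆ A k := fun k hk => (hCH k hk).trans (hAC k hk)
      rcases hsplit b hb with h | h
      · exact Rel.mono hI1e (fun k hk => hAH k (hI1e hk)) (fun _ _ => Finset.Subset.refl _)
          (hnc a ha b h)
      · obtain ⟨k4, hk4, hjk4⟩ := hc2.cov ⟨b, h⟩ j2 hj2
        refine (Rel.mono hI1e (fun k hk => hAH k (hI1e hk)) (fun _ _ => Finset.Subset.refl _)
          (hnc a ha k' hk')).trans ?_
        refine ReflTransGen.head (⟨hI1e hk', hI2e hk4, j2, hAC k' (hI1e hk') hj2C, hjk4⟩ :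
          Rel (I.erase i) A H k' k4) ?_
        exact Rel.mono hI2e (fun k hk => hAH k (hI2e hk)) (fun _ _ => Finset.Subset.refl _)
          (hc2.lk k4 hk4 b h)
    have hconnC : Conn (I.erase i) ((J₁ ∪ J₂) \ L) C := by
      have hp : ∀ b ∈ I.erase i, ReflTransGen (Rel (I.erase i) C C) k' b := fun b hb =>
        Rel.mono (Finset.Subset.refl _) (fun _ _ => Finset.Subset.refl _) hCH
          (hpath C (fun _ _ => Finset.Subset.refl _) k' hk' b hb)
      refine ⟨fun a ha b hb => (Rel.rev (hp a ha)).trans (hp b hb), ?_, ?_⟩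
      · intro _ j hj
        obtain ⟨h1, h2⟩ := Finset.mem_sdiff.1 hj
        rcases Finset.mem_union.1 h1 with h3 | h3
        · obtain ⟨k, hk, hjk⟩ := not_mem_leaves h3 h2
          exact ⟨k, hI1e hk, hCH k (hI1e hk) hjk⟩
        · rcases Finset.eq_empty_or_nonempty I₂ with he | hne
          · have := hc2.sg he j h3 j2 hj2
            exact ⟨k', hI1e hk', this ▸ hj2C⟩
          · obtain ⟨k, hk, hjk⟩ := hc2.cov hne j h3
            exact ⟨k, hI2e hk, hCH k (hI2e hk) hjk⟩
      · intro he
        have := hI1e hk'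
        rw [he] at this
        simp at this
    have hE : ∀ j' ∈ L, ∃ E ∈ M, (∀ k ∈ I.erase i, C k ⊆ E k) ∧ j' ∈ E i := by
      intro j' hj'
      obtain ⟨E, hEM, hCE, hEi, hor⟩ := lemE hPR hPS hce hT hi hGJ hj'
        (hT.sub H hH i hi (hLH hj')) hCM hCL hconnC
      refine ⟨E, hEM, hCE, ?_⟩
      rcases hor with ⟨k, hk, hjk⟩ | h
      · by_contra hnot
        obtain ⟨j, hj⟩ := hT.ne E hEM i hi
        have hjj : j ≠ j' := fun e => hnot (e ▸ hj)
        obtain ⟨hjG, hjL⟩ := Finset.mem_sdiff.1 (hEi hj)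
        have hjL' : j ∉ L := fun h => hjL (Finset.mem_erase.2 ⟨hjj, h⟩)
        have hjJ1 := hJ1 E hEM (fun k hk => (hCH k hk).trans (hCE k hk)) j hj
        obtain ⟨k3, hk3, hjk3⟩ := not_mem_leaves hjJ1 hjL'
        have := hT.cmp E hEM H hH k (hIe hk) i hi j' hjk (hLH hj') (by
          refine ReflTransGen.head (⟨hi, hIe (hI1e hk3), j, hj, hjk3⟩ : Rel I E H i k3) ?_
          exact Rel.mono hIe (fun _ _ => Finset.Subset.refl _) (fun _ _ => Finset.Subset.refl _)
            (hpath E hCE k3 hk3 k hk))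
        exact hkL k hk j' this hj'
      · rw [h]; simp
    obtain ⟨A, hAM, hAC, hAi⟩ := elim_union hT hi (C := C) (H i \ L) L
      ⟨C, hCM, fun _ _ => Finset.Subset.refl _, hCi⟩ hE
    refine ⟨A, hAM, ?_, k', Finset.mem_of_mem_erase hk', j2, hAC k' (hI1e hk') hj2C, hj2⟩
    intro k hk
    by_cases hki : k = i
    · subst hki
      rwa [Finset.sdiff_union_of_subset hLH] at hAi
    · have hke : k ∈ I.erase i := Finset.mem_erase.2 ⟨hki, hk⟩
      exact (hCH k hke).trans (hAC k hke)
  · push Not at hA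
    obtain ⟨i0, hi0, j0, hj0, hj0G⟩ := hfar
    have hii : i0 = i := by
      by_contra hne
      exact hA i0 (Finset.mem_erase.2 ⟨hne, hi0⟩) j0 hj0 hj0G
    subst hii
    set l : β → ℕ := fun j => if j ∈ J₂ then 0 else if j ∈ L then 2 else 1 with hl
    have hlow : ∀ k j, (∃ c ∈ G k, c ∈ J₂) → j ∈ Gl l G k → j ∈ J₂ := by
      rintro k j ⟨c, hc, hc2⟩ hj
      have := (mem_Gl.1 hj).2 c hc
      simp only [hl, if_pos hc2] at this
      by_contra hn
      rw [if_neg hn] at this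
      split_ifs at this <;> omega
    have hGB : ∀ k ∈ I₂, Gl l G k ⊆ J₂ := by
      intro k hk j hj
      obtain ⟨c, hc⟩ := hT.ne H hH k (hI2 hk)
      exact hlow k j ⟨c, hT.sub H hH k (hI2 hk) hc, hH2 k hk hc⟩ hj
    have hGA : ∀ k ∈ I₁.erase i0, Gl l G k ⊆ J₁ \ L := by
      intro k hk j hj
      have hkI := hIe (hI1e hk)
      obtain ⟨hjG, hjm⟩ := mem_Gl.1 hj
      have hj2 : j ∉ J₂ := fun h => hA k hk j h hjG
      refine Finset.mem_sdiff.2 ⟨(Finset.mem_union.1 (hGJ k hkI hjG)).resolve_right hj2, ?_⟩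
      intro hjL
      obtain ⟨c, hc⟩ := hT.ne H hH k hkI
      have := hjm c (hT.sub H hH k hkI hc)
      have hc2 : c ∉ J₂ := fun h => hA k hk c h (hT.sub H hH k hkI hc)
      simp only [hl, if_neg hc2, if_neg hj2, if_pos hjL, if_neg (hkL k (hI1e hk) c hc)] at this
      omega
    have hT' := hT.face (Finset.Subset.refl I) l
    obtain ⟨E, ⟨hEM, hEs⟩, hEA, hEB⟩ := R_two (H := H)
      (hPRs _ (hce ▸ Finset.card_le_card hI1e)) (hPRs _ (hce ▸ Finset.card_le_card hI2e)) hT'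
      (hI1e.trans hIe) hI2 (Finset.disjoint_of_subset_left Finset.sdiff_subset hJd) hGA hGB
      (by
        intro k hk j hj
        have hkI := hIe (hI1e hk)
        refine mem_Gl.2 ⟨hT.sub H hH k hkI hj, fun x hx => ?_⟩
        have hx2 : x ∉ J₂ := fun h => hA k hk x h hx
        simp only [hl, if_neg hx2, if_neg (hkL k (hI1e hk) j hj)]
        split_ifs <;> omega)
      (by
        intro k hk j hj
        refine mem_Gl.2 ⟨hT.sub H hH k (hI2 hk) hj, fun x hx => ?_⟩
        simp only [hl, if_pos (hH2 k hk hj)]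
        exact Nat.zero_le _)
      (fun k hk => hT.ne H hH k (hIe (hI1e hk))) (fun k hk => hT.ne H hH k (hI2 hk))
      hce' hc2 (fun A hA => ⟨hT.cmp A hA.1 H hH, hT.cmp H hH A hA.1⟩)
    apply hdone
    refine ⟨E, hEM, ?_, ?_⟩
    · intro k hk
      rcases hsplit k hk with h | h
      · exact (hEA k h).ge
      · exact (hEB k h).ge
    · obtain ⟨j, hj⟩ := hT.ne E hEM i0 hi
      exact ⟨j, hj, hlow i0 j ⟨j0, hj0G, hj0⟩ (hEs i0 hi hj)⟩

lemma PR_PS [Finite β] (n : ℕ) : (∀ m ≤ n, PR α β m) ∧ PS α β n := by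
  induction n with
  | zero =>
    refine ⟨fun m hm => ?_, PS_zero⟩
    rw [Nat.le_zero.1 hm]
    exact PR_zero
  | succ n ih =>
    refine ⟨fun m hm => ?_, PS_succ ih.1 ih.2⟩
    rcases Nat.le_succ_iff.1 hm with h | h
    · exact ih.1 m h
    · rw [h]
      exact PR_succ (ih.1 n le_rfl) ih.2


/-- Cyclic walks: the unrestricted form of compatibility. -/
lemma walk_compat {n d : ℕ} {A B : Fin n → Finset (Fin d)}
    (h : Compatible (typeEdges A) (typeEdges B)) :
    ∀ (m : ℕ) (x : ℕ → Fin n) (jj : ℕ → Fin d), (∀ t ≤ m, jj t ∈ A (x t)) →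
      (∀ t < m, jj t ∈ B (x (t + 1))) → jj m ∈ B (x 0) → jj m ∈ B (x m) := by
  intro m
  induction m using Nat.strong_induction_on with
  | _ m ih =>
  intro x jj hA hB h0
  by_cases hx : ∃ s t, s < t ∧ t ≤ m ∧ x s = x t
  · obtain ⟨s, t, hst, htm, hxe⟩ := hx
    have := ih (m - (t - s)) (by omega) (fun u => if u < s then x u else x (u + (t - s)))
      (fun u => if u < s then jj u else jj (u + (t - s))) ?_ ?_ ?_
    · try simp only at this
      rw [if_neg (by omega), if_neg (by omega)] at this
      rwa [show m - (t - s) + (t - s) = m by omega] at this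
    · intro u hu
      by_cases hus : u < s
      · simp only [if_pos hus]
        exact hA u (by omega)
      · simp only [if_neg hus]
        exact hA _ (by omega)
    · intro u hu
      by_cases hus : u < s
      · by_cases hus' : u + 1 < s
        · simp only [if_pos hus, if_pos hus']
          exact hB u (by omega)
        · have e : u + 1 = s := by omega
          simp only [if_pos hus, if_neg hus']
          rw [show u + 1 + (t - s) = t by omega, ← hxe, ← e]
          exact hB u (by omega)
      · have hus' : ¬ u + 1 < s := by omega
        simp only [if_neg hus, if_neg hus']
        rw [show u + 1 + (t - s) = u + (t - s) + 1 by omega]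
        exact hB _ (by omega)
    · try simp only
      rw [if_neg (show ¬ m - (t - s) < s by omega), show m - (t - s) + (t - s) = m by omega]
      by_cases hs : 0 < s
      · rw [if_pos hs]; exact h0
      · rw [if_neg hs]
        have e : s = 0 := by omega
        rw [show 0 + (t - s) = t by omega, ← hxe, e]
        exact h0
  by_cases hj : ∃ s t, s < t ∧ t ≤ m ∧ jj s = jj t
  · obtain ⟨s, t, hst, htm, hje⟩ := hj
    by_cases htm' : t = m
    · subst htm'
      have := ih (t - s - 1) (by omega) (fun u => x (u + s + 1)) (fun u => jj (u + s + 1))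
        (fun u hu => hA _ (by omega)) (fun u hu => ?_) ?_
      · try simp only at this
        rwa [show t - s - 1 + s + 1 = t by omega] at this
      · have := hB (u + s + 1) (by omega)
        rwa [show u + s + 1 + 1 = u + 1 + s + 1 by omega] at this
      · try simp only
        rw [show t - s - 1 + s + 1 = t by omega, ← hje, show 0 + s + 1 = s + 1 by omega]
        exact hB s hst
    · have := ih (m - (t - s)) (by omega) (fun u => if u ≤ s then x u else x (u + (t - s)))
        (fun u => if u ≤ s then jj u else jj (u + (t - s))) ?_ ?_ ?_
      · try simp only at this
        rw [if_neg (by omega), if_neg (by omega)] at this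
        rwa [show m - (t - s) + (t - s) = m by omega] at this
      · intro u hu
        by_cases hus : u ≤ s
        · simp only [if_pos hus]
          exact hA u (by omega)
        · simp only [if_neg hus]
          exact hA _ (by omega)
      · intro u hu
        by_cases hus : u ≤ s
        · by_cases hus' : u + 1 ≤ s
          · simp only [if_pos hus, if_pos hus']
            exact hB u (by omega)
          · have e : u = s := by omega
            simp only [if_pos hus, if_neg hus']
            rw [show u + 1 + (t - s) = t + 1 by omega, e, hje]
            exact hB t (by omega)
        · have hus' : ¬ u + 1 ≤ s := by omega
          simp only [if_neg hus, if_neg hus']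
          rw [show u + 1 + (t - s) = u + (t - s) + 1 by omega]
          exact hB _ (by omega)
      · try simp only
        rw [if_neg (show ¬ m - (t - s) ≤ s by omega), show m - (t - s) + (t - s) = m by omega,
          if_pos (Nat.zero_le s)]
        exact h0
  push Not at hx hj
  rcases m with _ | k
  · exact h0
  have inj : ∀ {γ : Type} (f : ℕ → γ), (∀ s t, s < t → t ≤ k + 1 → f s ≠ f t) →
      Function.Injective (fun t : Fin (k + 2) => f t) := by
    intro γ f hf a b hab
    rcases lt_trichotomy a b with h1 | h1 | h1
    · exact absurd hab (hf a b h1 (by omega))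
    · exact h1
    · exact absurd hab.symm (hf b a h1 (by omega))
  have := h k (fun t => x t) (fun t => jj t) (inj x hx) (inj jj hj)
    (fun t => hA t (by omega)) (fun t => ?_) (Fin.last (k + 1))
  · have h2 := this.2.1
    simpa [typeEdges] using h2
  · by_cases ht : t = Fin.last (k + 1)
    · subst ht
      simpa [typeEdges] using h0
    · have ht' : ((t + 1 : Fin (k + 2)) : ℕ) = t + 1 :=
        Fin.val_add_one_of_lt (Fin.lt_last_iff_ne_last.2 ht)
      have hlt : (t : ℕ) < k + 1 := Fin.lt_last_iff_ne_last.2 ht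
      show jj t ∈ B (x _)
      rw [ht']
      exact hB _ hlt

lemma KK_of_compat {n d : ℕ} {A B : Fin n → Finset (Fin d)}
    (h : Compatible (typeEdges A) (typeEdges B)) : KK Finset.univ A B := by
  intro i _ i' hi' j hj hj' hr
  clear hi'
  have key : ∃ (m : ℕ) (x : ℕ → Fin n) (jj : ℕ → Fin d), x 0 = i' ∧ x m = i ∧ jj m = j ∧
      (∀ t ≤ m, jj t ∈ A (x t)) ∧ (∀ t < m, jj t ∈ B (x (t + 1))) := by
    clear hj'
    induction hr using ReflTransGen.head_induction_on with
    | refl => exact ⟨0, fun _ => i, fun _ => j, rfl, rfl, rfl, fun _ _ => hj, fun t ht => by omega⟩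
    | head h1 h2 ih =>
      rename_i a c
      obtain ⟨m, x, jj, h0, hm, hjm, hA, hB⟩ := ih
      obtain ⟨_, _, j0, ha, hc⟩ := h1
      refine ⟨m + 1, fun t => Nat.casesOn t a x, fun t => Nat.casesOn t j0 jj, rfl, hm, hjm, ?_, ?_⟩
      · rintro (_ | t) ht
        · exact ha
        · exact hA t (by omega)
      · rintro (_ | t) ht
        · show j0 ∈ B (x 0)
          rw [h0]; exact hc
        · exact hB t (by omega)
  obtain ⟨m, x, jj, h0, hm, hjm, hA, hB⟩ := key
  have := walk_compat h m x jj hA hB (by rw [hjm, h0]; exact hj')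
  rwa [hjm, hm] at this

lemma exists_perm {d : ℕ} (r : Fin d → ℕ) (hr : Function.Injective r) :
    ∃ σ : Equiv.Perm (Fin d), ∀ a b, σ a ≤ σ b → r a ≤ r b := by
  refine ⟨(Tuple.sort r).symm, fun a b hab => ?_⟩
  have := Tuple.monotone_sort r hab
  simpa using this

lemma TOM_of_GTOM {n d : ℕ} {G : Finset (Fin n × Fin d)} {M : Set (Fin n → Finset (Fin d))}
    (hM : IsGTOM G M) (hne : M.Nonempty) : TOM Finset.univ (graphType G) M where
  ne := fun A hA i _ => hM.isType A hA i
  sub := fun A hA i _ j hj => by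
    have := hM.subgraph A hA (show (i, j) ∈ typeEdges A from hj)
    simpa [graphType] using this
  bd := by
    intro r hr
    obtain ⟨A, hA⟩ := hne
    have hG : ∀ i, (graphType G i).Nonempty := fun i => by
      obtain ⟨j, hj⟩ := hM.isType A hA i
      have := hM.subgraph A hA (show (i, j) ∈ typeEdges A from hj)
      exact ⟨j, by simpa [graphType] using this⟩
    obtain ⟨σ, hσ⟩ := exists_perm r hr
    choose f hf hf' using fun i => Finset.exists_min_image (graphType G i) σ (hG i)
    refine ⟨fun i => {f i}, hM.boundary σ _ fun i => ⟨f i, hf i, rfl, hf' i⟩, fun i _ =>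
      ⟨f i, hf i, rfl, fun j' hj' => hσ _ _ (hf' i j' hj')⟩⟩
  sur := by
    intro A hA U
    by_cases h0 : U = ∅
    · exact ⟨A, hA, fun i _ => by simp [h0]⟩
    by_cases h1 : Uᶜ = ∅
    · have h1 : U = Finset.univ := by simpa using h1
      exact ⟨A, hA, fun i _ => by simp [h1]⟩
    have h0 := Finset.nonempty_iff_ne_empty.2 h0
    have h1 := Finset.nonempty_iff_ne_empty.2 h1
    let P : OrderedPartition d :=
      { r := 2
        parts := ![U, Uᶜ]
        nonempty := by
          intro k
          fin_cases k
          · exact h0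
          · exact h1
        disjoint := by
          intro k l hkl
          fin_cases k <;> fin_cases l <;> simp_all [disjoint_compl_right, disjoint_compl_left]
        covers := by
          intro j
          by_cases hj : j ∈ U
          · exact ⟨0, hj⟩
          · exact ⟨1, by simpa using hj⟩ }
    refine ⟨fun i => if (A i ∩ U).Nonempty then A i ∩ U else A i, ?_, fun i _ => rfl⟩
    refine hM.surrounding A hA P _ fun i => ?_
    by_cases hi : (A i ∩ U).Nonempty
    · refine ⟨(0 : Fin 2), by simp [hi, P], hi, fun l hl => absurd hl (by exact Fin.not_lt_zero l)⟩
    · have hE : A i ∩ U = ∅ := Finset.not_nonempty_iff_eq_empty.1 hi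
      have hE' : A i ∩ Uᶜ = A i := by
        ext j
        simp only [Finset.mem_inter, Finset.mem_compl, and_iff_left_iff_imp]
        intro hj hjU
        exact hi ⟨j, Finset.mem_inter.2 ⟨hj, hjU⟩⟩
      refine ⟨(1 : Fin 2), ?_, ?_, ?_⟩
      · show (if (A i ∩ U).Nonempty then A i ∩ U else A i) = A i ∩ Uᶜ
        rw [if_neg hi, hE']
      · show (A i ∩ Uᶜ).Nonempty
        rw [hE']; exact hM.isType A hA i
      · intro (l : Fin 2) hl
        have : l = 0 := by
          have : (l : ℕ) < 1 := hl
          ext; simp; omega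
        subst this
        exact hE
  cmp := fun A hA B hB => KK_of_compat (hM.comparability A hA B hB)
  elim := fun A hA B hB i _ => by
    obtain ⟨C, hC, h1, h2⟩ := hM.elimination A hA B hB i
    exact ⟨C, hC, h1, fun i' _ => h2 i'⟩

lemma Conn_of_connOn {n d : ℕ} {I : Finset (Fin n)} {J : Finset (Fin d)}
    {H : Fin n → Finset (Fin d)} (hI : I.Nonempty)
    (hc : connOn ↑I ↑J (typeEdges H ∩ (↑I ×ˢ ↑J))) : Conn I J H := by
  have key : ∀ i : (↑I : Set (Fin n)), ∀ v : (↑I : Set (Fin n)) ⊕ (↑J : Set (Fin d)),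
      Sum.elim (fun i' => ReflTransGen (Rel I H H) i.1 i'.1)
        (fun j => ∃ i' ∈ I, ReflTransGen (Rel I H H) i.1 i' ∧ j.1 ∈ H i') v := by
    intro i v
    have hr := (SimpleGraph.reachable_iff_reflTransGen _ _).1 (hc.preconnected (Sum.inl i) v)
    induction hr with
    | refl => exact ReflTransGen.refl
    | tail h1 h2 ih =>
      obtain ⟨a, b, hab, (⟨rfl, rfl⟩ | ⟨rfl, rfl⟩)⟩ := h2
      · exact ⟨a, a.2, ih, hab.1⟩
      · obtain ⟨i', hi', hr, hj⟩ := ih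
        exact hr.tail ⟨hi', a.2, b.1, hj, hab.1⟩
  refine ⟨fun i hi i' hi' => key ⟨i, hi⟩ (Sum.inl ⟨i', hi'⟩), fun _ j hj => ?_, fun h => ?_⟩
  · obtain ⟨i, hi⟩ := hI
    obtain ⟨i', hi', _, h⟩ := key ⟨i, hi⟩ (Sum.inr ⟨j, hj⟩)
    exact ⟨i', hi', h⟩
  · exact absurd h hI.ne_empty

lemma reach_of_connOn {n d : ℕ} {I : Finset (Fin n)} {J : Finset (Fin d)}
    {H C : Fin n → Finset (Fin d)} (hHC : ∀ i, H i ⊆ C i)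
    (hc : connOn ↑I ↑J (typeEdges H ∩ (↑I ×ˢ ↑J)))
    (u v : (↑I : Set (Fin n)) ⊕ (↑J : Set (Fin d))) :
    (bipGraph (typeEdges C)).Reachable (Sum.map Subtype.val Subtype.val u)
      (Sum.map Subtype.val Subtype.val v) := by
  refine (hc.preconnected u v).map ⟨Sum.map Subtype.val Subtype.val, ?_⟩
  rintro a b ⟨i, j, hij, (⟨rfl, rfl⟩ | ⟨rfl, rfl⟩)⟩
  · exact ⟨i, j, hHC _ hij.1, Or.inl ⟨rfl, rfl⟩⟩
  · exact ⟨i, j, hHC _ hij.1, Or.inr ⟨rfl, rfl⟩⟩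

lemma conn_of_cross {n d : ℕ} {I₁ I₂ : Finset (Fin n)} {J₁ J₂ : Finset (Fin d)}
    {H C : Fin n → Finset (Fin d)} (hHC : ∀ i, H i ⊆ C i)
    (hIu : I₁ ∪ I₂ = Finset.univ) (hJu : J₁ ∪ J₂ = Finset.univ)
    (hc1 : connOn ↑I₁ ↑J₁ (typeEdges H ∩ (↑I₁ ×ˢ ↑J₁)))
    (hc2 : connOn ↑I₂ ↑J₂ (typeEdges H ∩ (↑I₂ ×ˢ ↑J₂)))
    {i : Fin n} {j : Fin d} (hi : i ∈ I₁) (hj : j ∈ J₂) (hij : j ∈ C i) :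
    IsConn (typeEdges C) := by
  have r1 := reach_of_connOn hHC hc1 (Sum.inl ⟨i, hi⟩)
  have r2 := reach_of_connOn hHC hc2 (Sum.inr ⟨j, hj⟩)
  have hadj : (bipGraph (typeEdges C)).Adj (Sum.inl i) (Sum.inr j) :=
    ⟨i, j, hij, Or.inl ⟨rfl, rfl⟩⟩
  have all : ∀ v, (bipGraph (typeEdges C)).Reachable (Sum.inl i) v := by
    rintro (a | b)
    · have : a ∈ I₁ ∪ I₂ := by rw [hIu]; exact Finset.mem_univ _
      rcases Finset.mem_union.1 this with h | h
      · exact r1 (Sum.inl ⟨a, h⟩)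
      · exact hadj.reachable.trans (r2 (Sum.inl ⟨a, h⟩))
    · have : b ∈ J₁ ∪ J₂ := by rw [hJu]; exact Finset.mem_univ _
      rcases Finset.mem_union.1 this with h | h
      · exact r1 (Sum.inr ⟨b, h⟩)
      · exact hadj.reachable.trans (r2 (Sum.inr ⟨b, h⟩))
  haveI : Nonempty (Fin n ⊕ Fin d) := ⟨Sum.inl i⟩
  exact ⟨fun u v => (all u).symm.trans (all v)⟩

lemma main {n d : ℕ}
    (G : Finset (Fin n × Fin d))
    (M : Set (Fin n → Finset (Fin d))) (hM : IsGTOM G M)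
    (H : Fin n → Finset (Fin d)) (hH : H ∈ M)
    (I₁ I₂ : Finset (Fin n)) (J₁ J₂ : Finset (Fin d))
    (hI : Disjoint I₁ I₂) (hIu : I₁ ∪ I₂ = Finset.univ)
    (hJ : Disjoint J₁ J₂) (hJu : J₁ ∪ J₂ = Finset.univ)
    (hHsub : ∀ i j, j ∈ H i → (i ∈ I₁ ∧ j ∈ J₁) ∨ (i ∈ I₂ ∧ j ∈ J₂))
    (hc1 : connOn ↑I₁ ↑J₁ (typeEdges H ∩ (↑I₁ ×ˢ ↑J₁)))
    (hc2 : connOn ↑I₂ ↑J₂ (typeEdges H ∩ (↑I₂ ×ˢ ↑J₂)))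
    (hG1 : ∃ p ∈ G, p.1 ∈ I₁ ∧ p.2 ∈ J₂)
    (hG2 : ∃ p ∈ G, p.1 ∈ I₂ ∧ p.2 ∈ J₁) :
    ∃ C₁ ∈ M, ∃ C₂ ∈ M,
      IsConn (typeEdges C₁) ∧ IsConn (typeEdges C₂) ∧
      (∀ i, H i ⊆ C₁ i) ∧ (∀ i, H i ⊆ C₂ i) ∧
      (∃ i j, j ∈ C₁ i ∧ i ∈ I₁ ∧ j ∈ J₂) ∧
      (∃ i j, j ∈ C₂ i ∧ i ∈ I₂ ∧ j ∈ J₁) ∧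
      C₁ ≠ C₂ := by
  obtain ⟨⟨a1, b2⟩, hg1, ha1, hb2⟩ := hG1
  obtain ⟨⟨a2, b1⟩, hg2, ha2, hb1⟩ := hG2
  have hT := TOM_of_GTOM hM ⟨H, hH⟩
  have cn1 := Conn_of_connOn ⟨a1, ha1⟩ hc1
  have cn2 := Conn_of_connOn ⟨a2, ha2⟩ hc2
  have hs1 : ∀ i ∈ I₁, H i ⊆ J₁ := by
    intro i hi j hj
    rcases hHsub i j hj with h | h
    · exact h.2
    · exact absurd h.1 (Finset.disjoint_left.1 hI hi)
  have hs2 : ∀ i ∈ I₂, H i ⊆ J₂ := by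
    intro i hi j hj
    rcases hHsub i j hj with h | h
    · exact absurd hi (Finset.disjoint_left.1 hI h.1)
    · exact h.2
  obtain ⟨C₁, hC1, hHC1, i1, hi1, j2, hj2C, hj2⟩ :=
    (PR_PS (α := Fin n) (β := Fin d) _).2 Finset.univ (graphType G) M I₁ I₂ J₁ J₂ H rfl hT hIu
      hI hJ (fun i _ => by rw [hJu]; exact Finset.subset_univ _) hH hs1 hs2 cn1 cn2
      ⟨a1, ha1, b2, hb2, by simpa [graphType] using hg1⟩
  obtain ⟨C₂, hC2, hHC2, i2, hi2, j1, hj1C, hj1⟩ :=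
    (PR_PS (α := Fin n) (β := Fin d) _).2 Finset.univ (graphType G) M I₂ I₁ J₂ J₁ H rfl hT
      (by rw [Finset.union_comm]; exact hIu)
      hI.symm hJ.symm (fun i _ => by rw [Finset.union_comm, hJu]; exact Finset.subset_univ _)
      hH hs2 hs1 cn2 cn1
      ⟨a2, ha2, b1, hb1, by simpa [graphType] using hg2⟩
  have hHC1 : ∀ i, H i ⊆ C₁ i := fun i => hHC1 i (Finset.mem_univ _)
  have hHC2 : ∀ i, H i ⊆ C₂ i := fun i => hHC2 i (Finset.mem_univ _)
  refine ⟨C₁, hC1, C₂, hC2, conn_of_cross hHC1 hIu hJu hc1 hc2 hi1 hj2 hj2C,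
    conn_of_cross hHC2 (by rw [Finset.union_comm]; exact hIu)
      (by rw [Finset.union_comm]; exact hJu) hc2 hc1 hi2 hj1 hj1C, hHC1, hHC2,
    ⟨i1, j2, hj2C, hi1, hj2⟩, ⟨i2, j1, hj1C, hi2, hj1⟩, ?_⟩
  rintro rfl
  obtain ⟨i', hi', hj2'⟩ := cn2.cov ⟨a2, ha2⟩ j2 hj2
  obtain ⟨i'', hi'', hj1'⟩ := cn1.cov ⟨a1, ha1⟩ j1 hj1
  have p1 : ReflTransGen (Rel Finset.univ C₁ H) i' i2 :=
    Rel.mono (Finset.subset_univ _) (fun i _ => hHC1 i) (fun _ _ => Finset.Subset.refl _)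
      (cn2.lk i' hi' i2 hi2)
  have p2 : ReflTransGen (Rel Finset.univ C₁ H) i'' i1 :=
    Rel.mono (Finset.subset_univ _) (fun i _ => hHC1 i) (fun _ _ => Finset.Subset.refl _)
      (cn1.lk i'' hi'' i1 hi1)
  have p : ReflTransGen (Rel Finset.univ C₁ H) i' i1 :=
    (p1.tail ⟨Finset.mem_univ _, Finset.mem_univ _, j1, hj1C, hj1'⟩).trans p2
  have := hT.cmp C₁ hC1 H hH i1 (Finset.mem_univ _) i' (Finset.mem_univ _) j2 hj2C hj2' p
  exact Finset.disjoint_left.1 hJ (hs1 i1 hi1 this) hj2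

end TOMProof

/-- a type `H ∈ M` whose graph splits into connected pieces `I₁ ⊔ J₁` and
`I₂ ⊔ J₂` is contained in two distinct connected types, one with an extra edge in
`I₁ × J₂` and one with an extra edge in `I₂ × J₁`. -/
theorem gtom_facet_two_cells {n d : ℕ} (hn : 0 < n) (hd : 0 < d)
    (G : Finset (Fin n × Fin d)) (hGconn : IsConn (↑G : Set (Fin n × Fin d)))
    (M : Set (Fin n → Finset (Fin d))) (hM : IsGTOM G M)
    (H : Fin n → Finset (Fin d)) (hH : H ∈ M)
    (I₁ I₂ : Finset (Fin n)) (J₁ J₂ : Finset (Fin d))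
    (hI : Disjoint I₁ I₂) (hIu : I₁ ∪ I₂ = Finset.univ)
    (hJ : Disjoint J₁ J₂) (hJu : J₁ ∪ J₂ = Finset.univ)
    (hHsub : ∀ i j, j ∈ H i → (i ∈ I₁ ∧ j ∈ J₁) ∨ (i ∈ I₂ ∧ j ∈ J₂))
    (hc1 : connOn ↑I₁ ↑J₁ (typeEdges H ∩ (↑I₁ ×ˢ ↑J₁)))
    (hc2 : connOn ↑I₂ ↑J₂ (typeEdges H ∩ (↑I₂ ×ˢ ↑J₂)))
    (hG1 : ∃ p ∈ G, p.1 ∈ I₁ ∧ p.2 ∈ J₂)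
    (hG2 : ∃ p ∈ G, p.1 ∈ I₂ ∧ p.2 ∈ J₁) :
    ∃ C₁ ∈ M, ∃ C₂ ∈ M,
      IsConn (typeEdges C₁) ∧ IsConn (typeEdges C₂) ∧
      (∀ i, H i ⊆ C₁ i) ∧ (∀ i, H i ⊆ C₂ i) ∧
      (∃ i j, j ∈ C₁ i ∧ i ∈ I₁ ∧ j ∈ J₂) ∧
      (∃ i j, j ∈ C₂ i ∧ i ∈ I₂ ∧ j ∈ J₁) ∧
      C₁ ≠ C₂ := by
  exact TOMProof.main G M hM H hH I₁ I₂ J₁ J₂ hI hIu hJ hJu hHsub hc1 hc2 hG1 hG2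
end

section
/- Let n, d be positive integers, and let Fin n = I_1 ⊔ I_2 and Fin d = J_1 ⊔ J_2 be partitions. Let H ⊆ (I_1 × J_1) ∪ (I_2 × J_2) be a subgraph such that the bipartite graph H ∩ (I_1 × J_1) on vertex set I_1 ⊕ J_1 is connected and the bipartite graph H ∩ (I_2 × J_2) on vertex set I_2 ⊕ J_2 is connected. Let A and B be compatible connected subgraphs of K_{n,d}, both containing H, such that A \ H and B \ H are both nonempty and both contained in I_1 × J_2. Then A = B. (Consequently, two distinct compatible cells sharing the facet encoded by H must have their extra edges on opposite sides: one connects I_1 to J_2 and the other connects I_2 to J_1.) -/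
open Finset Pointwise

/-- `Lev r a m a'`: `a'` can be reached from `a` in `m` double steps along `r`. -/
inductive Lev {α β : Type*} (r : α → β → Prop) (a : α) : ℕ → α → Prop
  | zero : Lev r a 0 a
  | succ {m : ℕ} {x y : α} {b : β} : Lev r a m x → r x b → r y b → Lev r a (m + 1) y

lemma lev_path {α β : Type*} [Nonempty β] (r : α → β → Prop) (a : α) :
    ∀ (m : ℕ) (a' : α), Lev r a m a' → (∀ k < m, ¬ Lev r a k a') →
    ∃ (x : ℕ → α) (y : ℕ → β), x 0 = a ∧ x m = a' ∧
      (∀ t < m, r (x t) (y t) ∧ r (x (t + 1)) (y t)) ∧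
      (∀ t ≤ m, Lev r a t (x t) ∧ ∀ k < t, ¬ Lev r a k (x t)) := by
  intro m
  induction m with
  | zero =>
    intro a' h _
    cases h
    refine ⟨fun _ => a, fun _ => Classical.arbitrary β, rfl, rfl, by simp, ?_⟩
    intro t ht
    obtain rfl : t = 0 := by omega
    exact ⟨Lev.zero, by simp⟩
  | succ m ih =>
    intro a' h hmin
    have h0 := h
    cases h with
    | succ h1 hb hb' =>
      rename_i a1 b
      obtain ⟨x, y, hx0, hxm, he, hl⟩ := ih a1 h1 (fun k hk hL =>
        hmin (k + 1) (by omega) (Lev.succ hL hb hb'))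
      refine ⟨fun t => if t ≤ m then x t else a', fun t => if t < m then y t else b,
        by simpa using hx0, by simp, ?_, ?_⟩
      · intro t ht
        by_cases htm : t < m
        · have : t ≤ m := by omega
          have h2 : t + 1 ≤ m := by omega
          simpa [htm, this, h2] using he t htm
        · obtain rfl : t = m := by omega
          simp [hxm, hb, hb']
      · intro t ht
        by_cases htm : t ≤ m
        · simpa [htm] using hl t htm
        · obtain rfl : t = m + 1 := by omega
          simpa using ⟨h0, fun k hk => hmin k (by omega)⟩

lemma inj_path {α β : Type*} [Nonempty β] (r : α → β → Prop) (a a' : α)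
    (h : ∃ m, Lev r a m a') :
    ∃ (m : ℕ) (x : ℕ → α) (y : ℕ → β), x 0 = a ∧ x m = a' ∧
      (∀ t < m, r (x t) (y t) ∧ r (x (t + 1)) (y t)) ∧
      (∀ s ≤ m, ∀ t ≤ m, x s = x t → s = t) ∧
      (∀ s < m, ∀ t < m, y s = y t → s = t) := by
  classical
  obtain ⟨x, y, hx0, hxm, he, hl⟩ := lev_path r a (Nat.find h) a' (Nat.find_spec h)
    (fun k hk => Nat.find_min h hk)
  refine ⟨Nat.find h, x, y, hx0, hxm, he, ?_, ?_⟩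
  · intro s hs t ht hst
    rcases lt_trichotomy s t with hlt | heq | hlt
    · exact absurd (hst ▸ (hl s hs).1) ((hl t ht).2 s hlt)
    · exact heq
    · exact absurd (hst ▸ (hl t ht).1) ((hl s hs).2 t hlt)
  · have key : ∀ s < Nat.find h, ∀ t < Nat.find h, s < t → y s ≠ y t := by
      intro s hs t ht hlt hy
      refine (hl (t + 1) (by omega)).2 (s + 1) (by omega) ?_
      exact Lev.succ (hl s (by omega)).1 (he s hs).1 (hy ▸ (he t ht).2)
    intro s hs t ht hst
    rcases lt_trichotomy s t with hlt | heq | hlt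
    · exact absurd hst (key s hs t ht hlt)
    · exact heq
    · exact absurd hst.symm (key t ht s hs hlt)

lemma conn_lev_left {n d : ℕ} {I : Set (Fin n)} {J : Set (Fin d)} {S : Set (Fin n × Fin d)}
    (h : connOn I J S) {a a' : Fin n} (ha : a ∈ I) (ha' : a' ∈ I) :
    ∃ m, Lev (fun i j => (i, j) ∈ S) a m a' := by
  have hr := h.preconnected (Sum.inl ⟨a, ha⟩) (Sum.inl ⟨a', ha'⟩)
  rw [SimpleGraph.reachable_iff_reflTransGen] at hr
  have key : ∀ v, Relation.ReflTransGen
      (bipGraph {p : ↥I × ↥J | ((p.1 : Fin n), (p.2 : Fin d)) ∈ S}).Adj (Sum.inl ⟨a, ha⟩) v →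
      Sum.elim (fun c : I => ∃ m, Lev (fun i j => (i, j) ∈ S) a m c)
        (fun b : J => ∃ m c, Lev (fun i j => (i, j) ∈ S) a m c ∧ (c, (b : Fin d)) ∈ S) v := by
    intro v hv
    induction hv with
    | refl => exact ⟨0, Lev.zero⟩
    | tail _ hadj ih =>
      obtain ⟨c, b, hcb, (⟨rfl, rfl⟩ | ⟨rfl, rfl⟩)⟩ := hadj
      · obtain ⟨m, hm⟩ := ih
        exact ⟨m, c, hm, hcb⟩
      · obtain ⟨m, c', hm, hc'⟩ := ih
        exact ⟨m + 1, Lev.succ hm hc' hcb⟩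
  exact key _ hr

lemma conn_lev_right {n d : ℕ} {I : Set (Fin n)} {J : Set (Fin d)} {S : Set (Fin n × Fin d)}
    (h : connOn I J S) {a a' : Fin d} (ha : a ∈ J) (ha' : a' ∈ J) :
    ∃ m, Lev (fun j i => (i, j) ∈ S) a m a' := by
  have hr := h.preconnected (Sum.inr ⟨a, ha⟩) (Sum.inr ⟨a', ha'⟩)
  rw [SimpleGraph.reachable_iff_reflTransGen] at hr
  have key : ∀ v, Relation.ReflTransGen
      (bipGraph {p : ↥I × ↥J | ((p.1 : Fin n), (p.2 : Fin d)) ∈ S}).Adj (Sum.inr ⟨a, ha⟩) v →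
      Sum.elim
        (fun b : I => ∃ m c, Lev (fun j i => (i, j) ∈ S) a m c ∧ ((b : Fin n), c) ∈ S)
        (fun c : J => ∃ m, Lev (fun j i => (i, j) ∈ S) a m c) v := by
    intro v hv
    induction hv with
    | refl => exact ⟨0, Lev.zero⟩
    | tail _ hadj ih =>
      obtain ⟨b, c, hcb, (⟨rfl, rfl⟩ | ⟨rfl, rfl⟩)⟩ := hadj
      · obtain ⟨m, c', hm, hc'⟩ := ih
        exact ⟨m + 1, Lev.succ hm hc' hcb⟩
      · obtain ⟨m, hm⟩ := ih
        exact ⟨m, c, hm, hcb⟩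
  exact key _ hr

lemma compat_nat {n d : ℕ} {A B : Set (Fin n × Fin d)} (h : Compatible A B) (k : ℕ)
    (f : ℕ → Fin n) (g : ℕ → Fin d)
    (hf : ∀ s < k + 2, ∀ t < k + 2, f s = f t → s = t)
    (hg : ∀ s < k + 2, ∀ t < k + 2, g s = g t → s = t)
    (hA : ∀ t < k + 2, (f t, g t) ∈ A)
    (hB : ∀ t < k + 1, (f (t + 1), g t) ∈ B) (hB0 : (f 0, g (k + 1)) ∈ B) :
    (∀ t < k + 2, (f t, g t) ∈ B) ∧ (f 0, g (k + 1)) ∈ A := by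
  have hh := h k (fun t => f t) (fun t => g t)
    (fun s t hst => Fin.ext (hf s s.2 t t.2 hst)) (fun s t hst => Fin.ext (hg s s.2 t t.2 hst))
    (fun t => hA t t.2) (by
      intro t
      by_cases ht : t = Fin.last (k + 1)
      · subst ht
        simpa using hB0
      · have hv : ((t + 1 : Fin (k + 2)) : ℕ) = t + 1 := by
          rw [Fin.val_add_one]; simp [ht]
        have hlt : (t : ℕ) < k + 1 := Fin.val_lt_last ht
        simp only [hv]
        exact hB t hlt)
  refine ⟨fun t ht => (hh ⟨t, ht⟩).2.1, ?_⟩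
  simpa using (hh (Fin.last (k + 1))).2.2.1

lemma exchange {n d : ℕ} (I₁ I₂ : Finset (Fin n)) (J₁ J₂ : Finset (Fin d))
    (hI : Disjoint I₁ I₂) (hJ : Disjoint J₁ J₂) (H : Set (Fin n × Fin d))
    (hc1 : connOn ↑I₁ ↑J₁ (H ∩ (↑I₁ ×ˢ ↑J₁)))
    (hc2 : connOn ↑I₂ ↑J₂ (H ∩ (↑I₂ ×ˢ ↑J₂)))
    (A B : Set (Fin n × Fin d)) (hcomp : Compatible A B)
    (hHA : H ⊆ A) (hHB : H ⊆ B) (i i' : Fin n) (j j' : Fin d)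
    (hi : i ∈ I₁) (hi' : i' ∈ I₁) (hj : j ∈ J₂) (hj' : j' ∈ J₂)
    (ha : (i, j) ∈ A) (hb : (i', j') ∈ B) : (i, j) ∈ B ∧ (i', j') ∈ A := by
  haveI : Nonempty (Fin n) := ⟨i⟩
  haveI : Nonempty (Fin d) := ⟨j⟩
  obtain ⟨p, x, y, hx0, hxp, hxy, hxi, hyi⟩ := inj_path _ i' i
    (conn_lev_left hc1 (by exact_mod_cast hi') (by exact_mod_cast hi))
  obtain ⟨q, u, v, hu0, huq, huv, hui, hvi⟩ := inj_path _ j j'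
    (conn_lev_right hc2 (by exact_mod_cast hj) (by exact_mod_cast hj'))
  simp only [Set.mem_inter_iff, Set.mem_prod, Finset.mem_coe] at hxy huv
  by_cases hpq : p + q = 0
  · obtain rfl : p = 0 := by omega
    obtain rfl : q = 0 := by omega
    have e1 : i' = i := hx0.symm.trans hxp
    have e2 : j = j' := hu0.symm.trans huq
    subst e1 e2
    exact ⟨hb, ha⟩
  obtain ⟨k, hk⟩ : ∃ k, p + q = k + 1 := ⟨p + q - 1, by omega⟩
  have hxI : ∀ t ≤ p, x t ∈ I₁ := by
    intro t ht
    rcases Nat.lt_or_eq_of_le ht with h | rfl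
    · exact (hxy t h).1.2.1
    · rwa [hxp]
  have huJ : ∀ t ≤ q, u t ∈ J₂ := by
    intro t ht
    rcases Nat.lt_or_eq_of_le ht with h | rfl
    · exact (huv t h).1.2.2
    · rwa [huq]
  have hyJ : ∀ t < p, y t ∈ J₁ := fun t ht => (hxy t ht).1.2.2
  have hvI : ∀ t < q, v t ∈ I₂ := fun t ht => (huv t ht).1.2.1
  have dI : ∀ s ≤ p, ∀ t < q, x s ≠ v t := fun s hs t ht e =>
    Finset.disjoint_left.mp hI (hxI s hs) (e ▸ hvI t ht)
  have dJ : ∀ s < p, ∀ t ≤ q, y s ≠ u t := fun s hs t ht e =>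
    Finset.disjoint_left.mp hJ (hyJ s hs) (e ▸ huJ t ht)
  have main := compat_nat hcomp k (fun t => if t ≤ p then x t else v (t - p - 1))
    (fun t => if t < p then y t else u (t - p)) ?_ ?_ ?_ ?_ ?_
  · have h1 := main.1 p (by omega)
    have h2 := main.2
    have e1 : ¬ (k + 1 < p) := by omega
    have e2 : k + 1 - p = q := by omega
    simp only [le_refl, lt_irrefl, if_true, if_false, Nat.sub_self, hxp, hu0] at h1
    simp only [Nat.zero_le, if_true, e1, if_false, e2, hx0, huq] at h2
    exact ⟨h1, h2⟩
  · intro s hs t ht hst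
    split_ifs at hst with h1 h2 h2
    · exact hxi s h1 t h2 hst
    · exact absurd hst (dI s h1 _ (by omega))
    · exact absurd hst.symm (dI t h2 _ (by omega))
    · have := hvi _ (by omega) _ (by omega) hst
      omega
  · intro s hs t ht hst
    split_ifs at hst with h1 h2 h2
    · exact hyi s h1 t h2 hst
    · exact absurd hst (dJ s h1 _ (by omega))
    · exact absurd hst.symm (dJ t h2 _ (by omega))
    · have := hui _ (by omega) _ (by omega) hst
      omega
  · intro t ht
    rcases lt_trichotomy t p with h | rfl | h
    · rw [if_pos h.le, if_pos h]
      exact hHA (hxy t h).1.1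
    · simpa [hxp, hu0] using ha
    · rw [if_neg (by omega), if_neg (by omega)]
      have := (huv (t - p - 1) (by omega)).2.1
      rw [show t - p - 1 + 1 = t - p by omega] at this
      exact hHA this
  · intro t ht
    by_cases h : t < p
    · rw [if_pos (by omega), if_pos h]
      exact hHB (hxy t h).2.1
    · rw [if_neg (by omega), if_neg h, show t + 1 - p - 1 = t - p by omega]
      exact hHB (huv (t - p) (by omega)).1.1
  · rw [if_pos (Nat.zero_le _), if_neg (by omega), show k + 1 - p = q by omega, hx0, huq]
    exact hb

/-- two compatible connected subgraphs containing `H` whose extra edges both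
lie in `I₁ × J₂` must coincide. -/
theorem compatible_same_side_eq {n d : ℕ} (hn : 0 < n) (hd : 0 < d)
    (I₁ I₂ : Finset (Fin n)) (J₁ J₂ : Finset (Fin d))
    (hI : Disjoint I₁ I₂) (hIu : I₁ ∪ I₂ = Finset.univ)
    (hJ : Disjoint J₁ J₂) (hJu : J₁ ∪ J₂ = Finset.univ)
    (H : Set (Fin n × Fin d))
    (hHsub : H ⊆ (↑I₁ ×ˢ ↑J₁) ∪ (↑I₂ ×ˢ ↑J₂))
    (hc1 : connOn ↑I₁ ↑J₁ (H ∩ (↑I₁ ×ˢ ↑J₁)))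
    (hc2 : connOn ↑I₂ ↑J₂ (H ∩ (↑I₂ ×ˢ ↑J₂)))
    (A B : Set (Fin n × Fin d)) (hcomp : Compatible A B)
    (hAconn : IsConn A) (hBconn : IsConn B)
    (hHA : H ⊆ A) (hHB : H ⊆ B)
    (hAne : (A \ H).Nonempty) (hBne : (B \ H).Nonempty)
    (hAside : A \ H ⊆ ↑I₁ ×ˢ ↑J₂) (hBside : B \ H ⊆ ↑I₁ ×ˢ ↑J₂) :
    A = B := by
  obtain ⟨⟨i, j⟩, hA⟩ := hAne
  obtain ⟨⟨i', j'⟩, hB⟩ := hBne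
  have mA := hAside hA
  have mB := hBside hB
  simp only [Set.mem_prod, Finset.mem_coe] at mA mB
  ext ⟨s, t⟩
  by_cases hH : (s, t) ∈ H
  · exact ⟨fun _ => hHB hH, fun _ => hHA hH⟩
  · constructor
    · intro h
      have m := hAside ⟨h, hH⟩
      simp only [Set.mem_prod, Finset.mem_coe] at m
      exact (exchange I₁ I₂ J₁ J₂ hI hJ H hc1 hc2 A B hcomp hHA hHB s i' t j'
        m.1 mB.1 m.2 mB.2 h hB.1).1
    · intro h
      have m := hBside ⟨h, hH⟩
      simp only [Set.mem_prod, Finset.mem_coe] at m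
      exact (exchange I₁ I₂ J₁ J₂ hI hJ H hc1 hc2 A B hcomp hHA hHB i s j t
        mA.1 m.1 mA.2 m.2 hA.1 h).2
end

section
/- Let n, d be positive integers, J : Fin n → Finset (Fin d) with J i nonempty for every i, and let P = ∑_{i ∈ Fin n} conv{e_j : j ∈ J i} ⊆ (Fin d → ℝ). Let ≼ be any linear order on Fin d, and for each i let f i be the ≼-minimal element of J i. Then the point ∑_{i ∈ Fin n} e_{f i} is an extreme point of P (it lies in Set.extremePoints ℝ P). In other words, every total refinement of the type i ↦ J i corresponds to a vertex of the generalized permutohedron P. -/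
open Finset Pointwise

lemma expose_convex {E : Type*} [AddCommGroup E] [Module ℝ E] (L : E →ₗ[ℝ] ℝ) (e : E) (c : ℝ) :
    Convex ℝ {x : E | c ≤ L x ∧ (L x = c → x = e)} := by
  rw [convex_iff_forall_pos]
  rintro x ⟨hx, hx'⟩ y ⟨hy, hy'⟩ a b ha hb hab
  have h1 : 0 ≤ a * (L x - c) := mul_nonneg ha.le (by linarith)
  have h2 : 0 ≤ b * (L y - c) := mul_nonneg hb.le (by linarith)
  have h3 : L (a • x + b • y) - c = a * (L x - c) + b * (L y - c) := by
    simp only [map_add, map_smul, smul_eq_mul]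
    linear_combination c * hab
  refine ⟨by linarith, fun h => ?_⟩
  have h4 : a * (L x - c) = 0 := by linarith
  have h5 : b * (L y - c) = 0 := by linarith
  have h6 : L x = c := by
    rcases mul_eq_zero.1 h4 with h | h <;> linarith
  have h7 : L y = c := by
    rcases mul_eq_zero.1 h5 with h | h <;> linarith
  rw [hx' h6, hy' h7, ← add_smul, hab, one_smul]

lemma gPerm_expose {n d : ℕ}
    (J : Fin n → Finset (Fin d)) (σ : Equiv.Perm (Fin d)) (f : Fin n → Fin d)
    (hf : ∀ i, f i ∈ J i ∧ ∀ j ∈ J i, σ (f i) ≤ σ j) :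
    ∃ (L : (Fin d → ℝ) →ₗ[ℝ] ℝ) (c : ℝ), L (∑ i, Pi.single (f i) (1 : ℝ)) = c ∧
      gPerm J ⊆ {x | c ≤ L x ∧ (L x = c → x = ∑ i, Pi.single (f i) (1 : ℝ))} := by
  let L : (Fin d → ℝ) →ₗ[ℝ] ℝ := ∑ j, ((σ j : ℕ) : ℝ) • LinearMap.proj j
  have hL : ∀ j, L (Pi.single j 1) = ((σ j : ℕ) : ℝ) := by
    intro j
    simp [L, LinearMap.sum_apply, Pi.single_apply]
  refine ⟨L, ∑ i, ((σ (f i) : ℕ) : ℝ), by simp [map_sum, hL], ?_⟩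
  intro x hx
  unfold gPerm at hx
  rw [Set.mem_fintype_sum] at hx
  obtain ⟨g, hg, rfl⟩ := hx
  have key : ∀ i, ((σ (f i) : ℕ) : ℝ) ≤ L (g i) ∧
      (L (g i) = ((σ (f i) : ℕ) : ℝ) → g i = Pi.single (f i) 1) := by
    intro i
    refine convexHull_min ?_ (expose_convex L (Pi.single (f i) 1) _) (hg i)
    rintro _ ⟨j, hj, rfl⟩
    have h := (hf i).2 j hj
    simp only [Set.mem_setOf_eq, hL]
    refine ⟨by exact_mod_cast h, fun h' => ?_⟩
    have : σ j = σ (f i) := Fin.ext (by exact_mod_cast h')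
    rw [σ.injective this]
  simp only [Set.mem_setOf_eq, map_sum]
  refine ⟨Finset.sum_le_sum fun i _ => (key i).1, fun h => ?_⟩
  have := (Finset.sum_eq_sum_iff_of_le fun i _ => (key i).1).1 h.symm
  exact Finset.sum_congr rfl fun i hi => (key i).2 (this i hi).symm

/-- for any linear order on `Fin d` (given by the rank function `σ`), the
point selecting the minimal element of each `J i` is an extreme point of the generalized
permutohedron; i.e. total refinements correspond to vertices. -/
theorem gPerm_totalRefinement_extremePoint {n d : ℕ} (hn : 0 < n) (hd : 0 < d)
    (J : Fin n → Finset (Fin d)) (hJ : ∀ i, (J i).Nonempty)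
    (σ : Equiv.Perm (Fin d)) (f : Fin n → Fin d)
    (hf : ∀ i, f i ∈ J i ∧ ∀ j ∈ J i, σ (f i) ≤ σ j) :
    (∑ i, Pi.single (f i) (1 : ℝ)) ∈ Set.extremePoints ℝ (gPerm J) := by
  obtain ⟨L, c, hv, hsub⟩ := gPerm_expose J σ f hf
  refine ⟨?_, ?_⟩
  · unfold gPerm
    rw [Set.mem_fintype_sum]
    exact ⟨_, fun i => subset_convexHull ℝ _ ⟨f i, (hf i).1, rfl⟩, rfl⟩
  · rintro x hx y hy ⟨a, b, ha, hb, hab, hxy⟩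
    obtain ⟨hx1, hx2⟩ := hsub hx
    obtain ⟨hy1, hy2⟩ := hsub hy
    apply hx2
    have h := congrArg L hxy
    rw [hv] at h
    simp only [map_add, map_smul, smul_eq_mul] at h
    have h1 : 0 ≤ a * (L x - c) := mul_nonneg ha.le (by linarith)
    have h2 : 0 ≤ b * (L y - c) := mul_nonneg hb.le (by linarith)
    have h3 : a * (L x - c) + b * (L y - c) = 0 := by
      linear_combination h - c * hab
    have h4 : a * (L x - c) = 0 := by linarith
    rcases mul_eq_zero.1 h4 with h | h <;> linarith
end

section
/- Let n, d be positive integers, J : Fin n → Finset (Fin d) with J i nonempty for every i, and P_G = ∑_{i ∈ Fin n} conv{e_j : j ∈ J i} ⊆ (Fin d → ℝ). Let P = (P_1, …, P_r) be an ordered partition of Fin d into nonempty parts, and for each i let J'_i = J i ∩ P_{k(i)} where k(i) is minimal with J i ∩ P_{k(i)} ≠ ∅ (the refinement of J by P). Define the linear functional c : (Fin d → ℝ) → ℝ by c(y) = ∑_{k=1}^{r} (r − k) · ∑_{j ∈ P_k} y_j. Then the set of maximizers of c over P_G equals the generalized permutohedron of the refinement: {x ∈ P_G : ∀ y ∈ P_G,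 c(y) ≤ c(x)} = ∑_{i ∈ Fin n} conv{e_j : j ∈ J'_i}. In particular, the refinement corresponds to an exposed face of P_G. -/
open Finset Pointwise

/-- Coordinates description of a face of the simplex. -/
theorem mem_simplexFace_iff {d : ℕ} (S : Finset (Fin d)) (x : Fin d → ℝ) :
    x ∈ convexHull ℝ ((fun j => (Pi.single j (1 : ℝ) : Fin d → ℝ)) '' ↑S) ↔
      (∀ j, 0 ≤ x j) ∧ (∑ j, x j = 1) ∧ ∀ j, j ∉ S → x j = 0 := by
  constructor
  · intro hx
    have hc : Convex ℝ {x : Fin d → ℝ |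
        (∀ j, 0 ≤ x j) ∧ (∑ j, x j = 1) ∧ ∀ j, j ∉ S → x j = 0} := by
      rintro x ⟨hx0, hx1, hx2⟩ y ⟨hy0, hy1, hy2⟩ a b ha hb hab
      refine ⟨fun j => ?_, ?_, fun j hj => ?_⟩
      · have := mul_nonneg ha (hx0 j)
        have := mul_nonneg hb (hy0 j)
        simp only [Pi.add_apply, Pi.smul_apply, smul_eq_mul]
        linarith
      · simp only [Pi.add_apply, Pi.smul_apply, smul_eq_mul, Finset.sum_add_distrib,
          ← Finset.mul_sum, hx1, hy1]
        linarith
      · simp [hx2 j hj, hy2 j hj]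
    refine convexHull_min ?_ hc hx
    rintro _ ⟨j, hj, rfl⟩
    refine ⟨fun k => ?_, ?_, fun k hk => ?_⟩
    · by_cases h : k = j
      · subst h; simp
      · simp [h]
    · simp
    · have h : k ≠ j := by
        rintro rfl
        exact hk hj
      simp [h]
  · rintro ⟨h0, h1, h2⟩
    have hs : ∑ j ∈ S, x j = 1 := by
      rw [← h1]
      exact Finset.sum_subset (Finset.subset_univ _) fun j _ hj => h2 j hj
    have hx : x = ∑ j ∈ S, x j • (Pi.single j (1 : ℝ) : Fin d → ℝ) := by
      rw [Finset.sum_subset (Finset.subset_univ S) fun j _ hj => by simp [h2 j hj]]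
      exact pi_eq_sum_univ' x
    rw [hx]
    exact (convex_convexHull ℝ _).sum_mem (fun j _ => h0 j) hs
      fun j hj => subset_convexHull ℝ _ ⟨j, hj, rfl⟩

/-- Maximizing a linear functional over a face of the simplex. -/
theorem simplexFace_max {d : ℕ} (S S' : Finset (Fin d)) (c : (Fin d → ℝ) →ₗ[ℝ] ℝ) (m : ℝ)
    (hS' : S' ⊆ S) (heq : ∀ j ∈ S', c (Pi.single j 1) = m)
    (hlt : ∀ j ∈ S, j ∉ S' → c (Pi.single j 1) < m) (x : Fin d → ℝ)
    (hx : x ∈ convexHull ℝ ((fun j => (Pi.single j (1 : ℝ) : Fin d → ℝ)) '' ↑S)) :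
    c x ≤ m ∧
      (c x = m ↔ x ∈ convexHull ℝ ((fun j => (Pi.single j (1 : ℝ) : Fin d → ℝ)) '' ↑S')) := by
  rw [mem_simplexFace_iff] at hx ⊢
  obtain ⟨h0, h1, h2⟩ := hx
  have hcx : m - c x = ∑ j, x j * (m - c (Pi.single j 1)) := by
    conv_lhs => rw [pi_eq_sum_univ' x]
    simp only [map_sum, map_smul, smul_eq_mul, mul_sub, Finset.sum_sub_distrib,
      ← Finset.sum_mul, h1, one_mul]
  have hnn : ∀ j ∈ Finset.univ, 0 ≤ x j * (m - c (Pi.single j 1)) := by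
    intro j _
    by_cases hj : j ∈ S
    · refine mul_nonneg (h0 j) ?_
      by_cases hj' : j ∈ S'
      · rw [heq j hj']; simp
      · linarith [hlt j hj hj']
    · simp [h2 j hj]
  refine ⟨by linarith [Finset.sum_nonneg hnn], ?_, ?_⟩
  · intro h
    refine ⟨h0, h1, fun j hj' => ?_⟩
    by_cases hj : j ∈ S
    · have hz : ∑ j, x j * (m - c (Pi.single j 1)) = 0 := by linarith
      rcases mul_eq_zero.1 ((Finset.sum_eq_zero_iff_of_nonneg hnn).1 hz j (Finset.mem_univ _))
        with h | h
      · exact h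
      · linarith [hlt j hj hj']
    · exact h2 j hj
  · rintro ⟨-, -, h3⟩
    have : ∑ j, x j * (m - c (Pi.single j 1)) = 0 := by
      refine Finset.sum_eq_zero fun j _ => ?_
      by_cases hj' : j ∈ S'
      · rw [heq j hj']; simp
      · simp [h3 j hj']
    linarith

/-- The functional attached to an ordered partition. -/
def partFun {d : ℕ} (P : OrderedPartition d) : (Fin d → ℝ) →ₗ[ℝ] ℝ where
  toFun y := ∑ k : Fin P.r, ((P.r - 1 - (k : ℕ) : ℕ) : ℝ) * ∑ j ∈ P.parts k, y j
  map_add' x y := by simp [Finset.sum_add_distrib, mul_add]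
  map_smul' a x := by
    simp only [Pi.smul_apply, smul_eq_mul, ← Finset.mul_sum, RingHom.id_apply]
    rw [Finset.mul_sum]
    exact Finset.sum_congr rfl fun k _ => by ring

theorem partFun_single {d : ℕ} (P : OrderedPartition d) (k : Fin P.r) (j : Fin d)
    (hj : j ∈ P.parts k) :
    partFun P (Pi.single j 1) = ((P.r - 1 - (k : ℕ) : ℕ) : ℝ) := by
  change ∑ l : Fin P.r, ((P.r - 1 - (l : ℕ) : ℕ) : ℝ) *
    ∑ i ∈ P.parts l, (Pi.single j 1 : Fin d → ℝ) i = _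
  rw [Finset.sum_eq_single k]
  · rw [Finset.sum_pi_single', if_pos hj, mul_one]
  · intro l _ hl
    rw [Finset.sum_pi_single', if_neg, mul_zero]
    exact fun h => Finset.disjoint_left.1 (P.disjoint l k hl) h hj
  · simp

/-- the refinement of `J` by an ordered partition `P` of `Fin d` is the face
of the generalized permutohedron maximizing the functional
`y ↦ ∑ₖ (r − k) ∑_{j ∈ Pₖ} y_j`. -/
theorem gPerm_refinement_is_exposed_face {n d : ℕ} (hn : 0 < n) (hd : 0 < d)
    (J : Fin n → Finset (Fin d)) (hJ : ∀ i, (J i).Nonempty)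
    (P : OrderedPartition d) (J' : Fin n → Finset (Fin d))
    (hJ' : IsRefinement J P J') :
    {x ∈ gPerm J | ∀ y ∈ gPerm J,
        (∑ k : Fin P.r, ((P.r - 1 - (k : ℕ) : ℕ) : ℝ) * ∑ j ∈ P.parts k, y j) ≤
          ∑ k : Fin P.r, ((P.r - 1 - (k : ℕ) : ℕ) : ℝ) * ∑ j ∈ P.parts k, x j} =
      gPerm J' := by
  change {x ∈ gPerm J | ∀ y ∈ gPerm J, partFun P y ≤ partFun P x} = gPerm J'
  choose k hk hne hmin using hJ'
  set m : Fin n → ℝ := fun i => ((P.r - 1 - (k i : ℕ) : ℕ) : ℝ) with hm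
  have hsub : ∀ i, J' i ⊆ J i := fun i => by rw [hk i]; exact Finset.inter_subset_left
  have heq : ∀ i, ∀ j ∈ J' i, partFun P (Pi.single j 1) = m i := by
    intro i j hj
    rw [hk i] at hj
    exact partFun_single P (k i) j (Finset.mem_inter.1 hj).2
  have hlt : ∀ i, ∀ j ∈ J i, j ∉ J' i → partFun P (Pi.single j 1) < m i := by
    intro i j hj hj'
    obtain ⟨l, hl⟩ := P.covers j
    rw [partFun_single P l j hl, hm]
    have h1 : k i < l := by
      rcases lt_trichotomy l (k i) with h | h | h
      · have := hmin i l h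
        exact absurd (Finset.mem_inter.2 ⟨hj, hl⟩) (by simp [this])
      · subst h
        exact absurd (by rw [hk i]; exact Finset.mem_inter.2 ⟨hj, hl⟩) hj'
      · exact h
    have h2 : (k i : ℕ) < l := h1
    have h3 := l.isLt
    exact Nat.cast_lt.2 (by omega)
  have key := fun i => simplexFace_max (J i) (J' i) (partFun P) (m i) (hsub i) (heq i) (hlt i)
  have hmono : ∀ i, convexHull ℝ ((fun j => (Pi.single j (1 : ℝ) : Fin d → ℝ)) '' ↑(J' i)) ⊆
      convexHull ℝ ((fun j => (Pi.single j (1 : ℝ) : Fin d → ℝ)) '' ↑(J i)) := fun i =>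
    convexHull_mono (Set.image_mono (Finset.coe_subset.2 (hsub i)))
  ext x
  constructor
  · rintro ⟨hx, hmax⟩
    obtain ⟨g, hg, rfl⟩ := (Set.mem_fintype_sum _ _).1 hx
    have hne' : ∀ i, (J' i).Nonempty := fun i => by rw [hk i]; exact hne i
    choose z hz using hne'
    have hy := hmax (∑ i, Pi.single (z i) 1) ((Set.mem_fintype_sum _ _).2
      ⟨_, fun i => subset_convexHull ℝ _ ⟨z i, hsub i (hz i), rfl⟩, rfl⟩)
    simp only [map_sum] at hy
    rw [Finset.sum_congr rfl fun i _ => heq i (z i) (hz i)] at hy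
    have hle : ∀ i ∈ Finset.univ, partFun P (g i) ≤ m i := fun i _ => (key i _ (hg i)).1
    have hall := (Finset.sum_eq_sum_iff_of_le hle).1 (le_antisymm (Finset.sum_le_sum hle) hy)
    exact (Set.mem_fintype_sum _ _).2
      ⟨g, fun i => (key i _ (hg i)).2.1 (hall i (Finset.mem_univ _)), rfl⟩
  · intro hx
    obtain ⟨g, hg, rfl⟩ := (Set.mem_fintype_sum _ _).1 hx
    refine ⟨(Set.mem_fintype_sum _ _).2 ⟨g, fun i => hmono i (hg i), rfl⟩, fun y hy => ?_⟩
    obtain ⟨f, hf, rfl⟩ := (Set.mem_fintype_sum _ _).1 hy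
    simp only [map_sum]
    refine Finset.sum_le_sum fun i _ => ?_
    rw [(key i _ (hmono i (hg i))).2.2 (hg i)]
    exact (key i _ (hf i)).1
end

section
/- Let n, d be positive integers and G ⊆ Fin n × Fin d a subgraph. Let Fin n = I_1 ⊔ I_2 and Fin d = J_1 ⊔ J_2 be partitions, set H = G ∩ ((I_1 × J_1) ∪ (I_2 × J_2)), and suppose H is nonempty and G \ H ⊆ I_1 × J_2 (i.e. G has no edges in I_2 × J_1). Define the linear functional c on (Fin n → ℝ) × (Fin d → ℝ) by c(x, y) = ∑_{i ∈ I_2} x_i + ∑_{j ∈ J_1} y_j, and let Q_G (resp. Q_H) be the convex hull of {(e_i, e_j) : (i,j) ∈ G} (resp. (i,j) ∈ H). Then the set of maximizers of c over Q_G equals Q_H: {p ∈ Q_G : ∀ q ∈ Q_G, c(q) ≤ c(p)} = Q_H. In particular Q_H is an exposed face of Q_G, and it is a proper face whenever G \ H is nonempty. -/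
open Finset Pointwise

/-- The linear functional of the theorem. -/
def facetFun {n d : ℕ} (I : Finset (Fin n)) (J : Finset (Fin d)) :
    ((Fin n → ℝ) × (Fin d → ℝ)) →ₗ[ℝ] ℝ where
  toFun q := ∑ i ∈ I, q.1 i + ∑ j ∈ J, q.2 j
  map_add' x y := by
    simp only [Prod.fst_add, Prod.snd_add, Pi.add_apply, Finset.sum_add_distrib]
    ring
  map_smul' a x := by
    simp only [Prod.smul_fst, Prod.smul_snd, Pi.smul_apply, smul_eq_mul, ← Finset.mul_sum,
      RingHom.id_apply]
    ring

theorem facetFun_rootVert {n d : ℕ} (I : Finset (Fin n)) (J : Finset (Fin d))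
    (p : Fin n × Fin d) :
    facetFun I J (rootVert p) = (if p.1 ∈ I then 1 else 0) + (if p.2 ∈ J then 1 else 0) := by
  simp [facetFun, rootVert, Pi.single_apply]

/-- If a functional is `1` on `T` and `< 1` on the other generators, the part of the hull at
level `1` is the hull of `T`. -/
theorem hull_level {E : Type*} [AddCommGroup E] [Module ℝ E] (c : E →ₗ[ℝ] ℝ) (S T : Set E)
    (h : ∀ x ∈ S, c x ≤ 1 ∧ (c x = 1 → x ∈ T)) :
    ∀ x ∈ convexHull ℝ S, c x ≤ 1 ∧ (c x = 1 → x ∈ convexHull ℝ T) := by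
  have key : convexHull ℝ S ⊆ {x | c x ≤ 1 ∧ (c x = 1 → x ∈ convexHull ℝ T)} := by
    refine convexHull_min (fun x hx => ⟨(h x hx).1, fun e => subset_convexHull ℝ T ((h x hx).2 e)⟩) ?_
    rintro x ⟨hx, hx'⟩ y ⟨hy, hy'⟩ a b ha hb hab
    have e : c (a • x + b • y) = a * c x + b * c y := by simp
    refine ⟨by rw [e]; nlinarith, fun h1 => ?_⟩
    rw [e] at h1
    rcases ha.eq_or_lt with rfl | ha'
    · obtain rfl : b = 1 := by linarith
      simpa using hy' (by linarith)
    rcases hb.eq_or_lt with rfl | hb'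
    · obtain rfl : a = 1 := by linarith
      simpa using hx' (by linarith)
    exact convex_convexHull ℝ T (hx' (le_antisymm hx (by nlinarith)))
      (hy' (le_antisymm hy (by nlinarith))) ha hb hab
  exact key

/-- if `G` has no edges in `I₂ × J₁`, then `Q_H`, for
`H = G ∩ ((I₁ × J₁) ∪ (I₂ × J₂))`, is the face of `Q_G` maximizing the functional
`(x, y) ↦ ∑_{i ∈ I₂} x_i + ∑_{j ∈ J₁} y_j`; in particular it is an exposed face. -/
theorem rootPoly_facet_maximizers {n d : ℕ} (hn : 0 < n) (hd : 0 < d)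
    (G : Finset (Fin n × Fin d))
    (I₁ I₂ : Finset (Fin n)) (J₁ J₂ : Finset (Fin d))
    (hI : Disjoint I₁ I₂) (hIu : I₁ ∪ I₂ = Finset.univ)
    (hJ : Disjoint J₁ J₂) (hJu : J₁ ∪ J₂ = Finset.univ)
    (H : Finset (Fin n × Fin d))
    (hH : H = G.filter (fun p => (p.1 ∈ I₁ ∧ p.2 ∈ J₁) ∨ (p.1 ∈ I₂ ∧ p.2 ∈ J₂)))
    (hHne : H.Nonempty)
    (hside : ∀ p ∈ G \ H, p.1 ∈ I₁ ∧ p.2 ∈ J₂) :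
    {p ∈ rootPoly (↑G : Set (Fin n × Fin d)) |
        ∀ q ∈ rootPoly (↑G : Set (Fin n × Fin d)),
          (∑ i ∈ I₂, q.1 i + ∑ j ∈ J₁, q.2 j) ≤ ∑ i ∈ I₂, p.1 i + ∑ j ∈ J₁, p.2 j} =
      rootPoly (↑H : Set (Fin n × Fin d)) := by
  change {p ∈ rootPoly (↑G : Set (Fin n × Fin d)) |
        ∀ q ∈ rootPoly (↑G : Set (Fin n × Fin d)), facetFun I₂ J₁ q ≤ facetFun I₂ J₁ p} = _
  have hHG : H ⊆ G := by rw [hH]; exact Finset.filter_subset _ _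
  have vH : ∀ p ∈ H, facetFun I₂ J₁ (rootVert p) = 1 := by
    intro p hp
    rw [hH, Finset.mem_filter] at hp
    rw [facetFun_rootVert]
    rcases hp.2 with ⟨h1, h2⟩ | ⟨h1, h2⟩
    · simp [Finset.disjoint_left.mp hI h1, h2]
    · simp [Finset.disjoint_right.mp hJ h2, h1]
  have vG : ∀ p ∈ G, p ∉ H → facetFun I₂ J₁ (rootVert p) = 0 := by
    intro p hp hp'
    obtain ⟨h1, h2⟩ := hside p (Finset.mem_sdiff.mpr ⟨hp, hp'⟩)
    rw [facetFun_rootVert]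
    simp [Finset.disjoint_left.mp hI h1, Finset.disjoint_right.mp hJ h2]
  have lvl := hull_level (facetFun I₂ J₁) (rootVert '' (↑G : Set (Fin n × Fin d)))
    (rootVert '' (↑H : Set (Fin n × Fin d))) (by
      rintro _ ⟨p, hp, rfl⟩
      by_cases hp' : p ∈ H
      · exact ⟨(vH p hp').le, fun _ => ⟨p, hp', rfl⟩⟩
      · rw [vG p hp hp']
        exact ⟨zero_le_one, fun h => absurd h zero_ne_one⟩)
  have hsub : rootPoly (↑H : Set (Fin n × Fin d)) ⊆ rootPoly (↑G : Set (Fin n × Fin d)) :=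
    convexHull_mono (Set.image_mono (Finset.coe_subset.mpr hHG))
  have hone : ∀ x ∈ rootPoly (↑H : Set (Fin n × Fin d)), facetFun I₂ J₁ x = 1 := by
    have : rootPoly (↑H : Set (Fin n × Fin d)) ⊆ {x | facetFun I₂ J₁ x = 1} := by
      refine convexHull_min ?_ (convex_hyperplane (facetFun I₂ J₁).isLinear 1)
      rintro _ ⟨p, hp, rfl⟩
      exact vH p hp
    exact this
  ext x
  constructor
  · rintro ⟨hx, hmax⟩
    obtain ⟨p, hp⟩ := hHne
    have h1 := hmax (rootVert p) (subset_convexHull ℝ _ ⟨p, hHG hp, rfl⟩)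
    rw [vH p hp] at h1
    exact (lvl x hx).2 (le_antisymm (lvl x hx).1 h1)
  · intro hx
    refine ⟨hsub hx, fun q hq => ?_⟩
    rw [hone x hx]
    exact (lvl q hq).1
end
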